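/- arXiv:1212.0441 — 6 statements merged into one kernel-verified Lean document; each statement's English description precedes it below -/
import Mathlib

section
/- For every real a > 0, the digamma function satisfies ψ(a) = log a − 1/(2a) + 2·∑_{n=1}^∞ [cos(2nπa)·Ci(2nπa) + sin(2nπa)·si(2nπa)], where the series on the right converges. -/
open Real Filter MeasureTheory Topology

/-- The digamma function `ψ(x) = Γ'(x)/Γ(x)`. -/
noncomputable def digamma (x : ℝ) : ℝ := deriv Real.Gamma x / Real.Gamma x

/-- The cosine integral `Ci(x) = -∫_x^∞ (cos t)/t dt`, as the limit of
`-∫_x^b (cos t)/t dt` as `b → ∞`. -/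
noncomputable def Ci (x : ℝ) : ℝ :=
  - limUnder atTop (fun b : ℝ => ∫ t in x..b, Real.cos t / t)

/-- The sine integral `si(x) = -∫_x^∞ (sin t)/t dt`, as the limit of
`-∫_x^b (sin t)/t dt` as `b → ∞`. -/
noncomputable def si (x : ℝ) : ℝ :=
  - limUnder atTop (fun b : ℝ => ∫ t in x..b, Real.sin t / t)

/-- Integrability of a bounded continuous function times `t⁻³` on `(x, ∞)`. -/
lemma aux_integrable (x : ℝ) (hx : 0 < x) (f : ℝ → ℝ) (hf : Measurable f) (C : ℝ)
    (hC : ∀ t, |f t| ≤ C) : IntegrableOn (fun t => f t / t ^ 3) (Set.Ioi x) := by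
  have h3 : IntegrableOn (fun t : ℝ => C * t ^ (-3 : ℝ)) (Set.Ioi x) :=
    (integrableOn_Ioi_rpow_of_lt (by norm_num) hx).const_mul C
  refine Integrable.mono' h3 (hf.div (measurable_id.pow_const 3)).aestronglyMeasurable ?_
  filter_upwards [ae_restrict_mem measurableSet_Ioi] with t ht
  have ht0 : 0 < t := hx.trans ht
  have : t ^ (-3 : ℝ) = (t ^ 3)⁻¹ := by
    rw [Real.rpow_neg ht0.le]; norm_cast
  rw [this, norm_div, Real.norm_eq_abs, Real.norm_eq_abs, abs_of_pos (pow_pos ht0 3), div_eq_mul_inv]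
  exact mul_le_mul_of_nonneg_right (hC t) (by positivity)

lemma aux_tendsto (x s : ℝ) (hx : 0 < x) :
    Tendsto (fun b : ℝ => ∫ t in x..b, Real.cos (t - s) / t) atTop
      (𝓝 (2 * (∫ t in Set.Ioi x, (1 - Real.cos (t - s)) / t ^ 3)
        - (Real.sin (x - s) / x + (1 - Real.cos (x - s)) / x ^ 2))) := by
  have hint := aux_integrable x hx (fun t => 1 - Real.cos (t - s)) (by fun_prop) 2 (by
    intro t
    rw [abs_le]
    constructor <;> linarith [Real.cos_le_one (t - s), Real.neg_one_le_cos (t - s)])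
  have hlim := intervalIntegral_tendsto_integral_Ioi x hint tendsto_id
  have h1 : Tendsto (fun b : ℝ => Real.sin (b - s) / b) atTop (𝓝 0) := by
    refine squeeze_zero_norm' (a := fun b : ℝ => b⁻¹) ?_ tendsto_inv_atTop_zero
    filter_upwards [eventually_gt_atTop 0] with b hb
    rw [norm_div, Real.norm_eq_abs, Real.norm_eq_abs, abs_of_pos hb, div_eq_mul_inv]
    exact mul_le_of_le_one_left (by positivity) (Real.abs_sin_le_one _)
  have h2 : Tendsto (fun b : ℝ => (1 - Real.cos (b - s)) / b ^ 2) atTop (𝓝 0) := by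
    have h0 : Tendsto (fun b : ℝ => 2 * (b ^ 2)⁻¹) atTop (𝓝 0) := by
      simpa using ((tendsto_pow_atTop (α := ℝ) two_ne_zero).inv_tendsto_atTop).const_mul 2
    refine squeeze_zero_norm' ?_ h0
    filter_upwards [eventually_gt_atTop 0] with b hb
    rw [norm_div, Real.norm_eq_abs, Real.norm_eq_abs, abs_of_pos (pow_pos hb 2), div_eq_mul_inv]
    refine mul_le_mul_of_nonneg_right ?_ (by positivity)
    rw [abs_le]
    constructor <;> linarith [Real.cos_le_one (b - s), Real.neg_one_le_cos (b - s)]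
  have key : Tendsto (fun b : ℝ => 2 * (∫ t in x..id b, (1 - Real.cos (t - s)) / t ^ 3)
      + ((Real.sin (b - s) / b + (1 - Real.cos (b - s)) / b ^ 2)
        - (Real.sin (x - s) / x + (1 - Real.cos (x - s)) / x ^ 2))) atTop
      (𝓝 (2 * (∫ t in Set.Ioi x, (1 - Real.cos (t - s)) / t ^ 3) + ((0 + 0)
        - (Real.sin (x - s) / x + (1 - Real.cos (x - s)) / x ^ 2)))) :=
    (hlim.const_mul 2).add ((h1.add h2).sub_const _)
  have e : ∀ A B : ℝ, A - B = A + ((0 + 0) - B) := by intros; ring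
  rw [e]
  refine key.congr' ?_
  filter_upwards [eventually_ge_atTop x] with b hb
  have hpos : ∀ t ∈ Set.uIcc x b, 0 < t := by
    intro t ht
    rw [Set.uIcc_of_le hb] at ht
    exact hx.trans_le ht.1
  have c1 : IntervalIntegrable (fun t => Real.cos (t - s) / t) volume x b := by
    apply ContinuousOn.intervalIntegrable
    exact ContinuousOn.div (by fun_prop) (by fun_prop) (fun t ht => (hpos t ht).ne')
  have c2 : IntervalIntegrable (fun t => (1 - Real.cos (t - s)) / t ^ 3) volume x b := by
    apply ContinuousOn.intervalIntegrable
    exact ContinuousOn.div (by fun_prop) (by fun_prop) (fun t ht => (pow_pos (hpos t ht) 3).ne')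
  have ftc := intervalIntegral.integral_eq_sub_of_hasDerivAt
    (f := fun t => Real.sin (t - s) / t + (1 - Real.cos (t - s)) / t ^ 2)
    (f' := fun t => Real.cos (t - s) / t - 2 * ((1 - Real.cos (t - s)) / t ^ 3)) (a := x) (b := b)
    (by
      intro t ht
      have ht0 := (hpos t ht).ne'
      have hd : HasDerivAt (fun t : ℝ => t - s) 1 t := (hasDerivAt_id t).sub_const s
      have := (hd.sin.div (hasDerivAt_id t) ht0).add
        ((hd.cos.const_sub 1).div (hasDerivAt_pow 2 t) (pow_ne_zero 2 ht0))
      convert! this using 1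
      simp only [id]
      field_simp
      push_cast
      ring)
    (c1.sub (c2.const_mul 2))
  rw [intervalIntegral.integral_sub c1 (c2.const_mul 2), intervalIntegral.integral_const_mul] at ftc
  simp only [id]
  linarith

lemma Ci_tendsto (x : ℝ) (hx : 0 < x) :
    Tendsto (fun b : ℝ => ∫ t in x..b, Real.cos t / t) atTop (𝓝 (-Ci x)) := by
  have h := aux_tendsto x 0 hx
  simp only [sub_zero] at h
  rw [Ci, neg_neg, h.limUnder_eq]
  exact h

lemma si_tendsto (x : ℝ) (hx : 0 < x) :
    Tendsto (fun b : ℝ => ∫ t in x..b, Real.sin t / t) atTop (𝓝 (-si x)) := by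
  have h := aux_tendsto x (π / 2) hx
  simp only [Real.cos_sub_pi_div_two] at h
  rw [si, neg_neg, h.limUnder_eq]
  exact h

lemma aux_term (x : ℝ) (hx : 0 < x) :
    Real.cos x * Ci x + Real.sin x * si x
      = - (2 * ∫ t in Set.Ioi x, (1 - Real.cos (t - x)) / t ^ 3) := by
  have h := aux_tendsto x x hx
  simp only [sub_self, Real.sin_zero, Real.cos_zero, zero_div, add_zero, sub_zero] at h
  have h2 := ((Ci_tendsto x hx).const_mul (Real.cos x)).add
    ((si_tendsto x hx).const_mul (Real.sin x))
  have h3 := tendsto_nhds_unique (h.congr' ?_) h2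
  · linarith
  filter_upwards [eventually_ge_atTop x] with b hb
  have hpos : ∀ t ∈ Set.uIcc x b, t ≠ 0 := by
    intro t ht
    rw [Set.uIcc_of_le hb] at ht
    exact (hx.trans_le ht.1).ne'
  have c1 : IntervalIntegrable (fun t => Real.cos t / t) volume x b := by
    apply ContinuousOn.intervalIntegrable
    exact ContinuousOn.div (by fun_prop) (by fun_prop) hpos
  have c2 : IntervalIntegrable (fun t => Real.sin t / t) volume x b := by
    apply ContinuousOn.intervalIntegrable
    exact ContinuousOn.div (by fun_prop) (by fun_prop) hpos
  rw [← intervalIntegral.integral_const_mul, ← intervalIntegral.integral_const_mul,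
    ← intervalIntegral.integral_add (c1.const_mul _) (c2.const_mul _)]
  congr 1
  ext t
  rw [Real.cos_sub]
  ring

lemma aux_fourier (u : ℝ) :
    HasSum (fun n : ℕ => (1 - Real.cos (2 * π * ((n : ℝ) + 1) * u)) / ((n : ℝ) + 1) ^ 2)
      (π ^ 2 * (Int.fract u - Int.fract u ^ 2)) := by
  have h1 := hasSum_one_div_nat_pow_mul_cos (k := 1) one_ne_zero (x := Int.fract u)
    ⟨Int.fract_nonneg u, (Int.fract_lt_one u).le⟩
  have h2 : HasSum (fun n : ℕ => (1 - Real.cos (2 * π * (n : ℝ) * u)) / (n : ℝ) ^ 2)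
      (π ^ 2 * (Int.fract u - Int.fract u ^ 2)) := by
    convert! hasSum_zeta_two.sub h1 using 1
    · ext n
      have : Real.cos (2 * π * n * Int.fract u) = Real.cos (2 * π * n * u) := by
        rw [← Int.self_sub_floor]
        have : 2 * π * n * (u - ⌊u⌋) = 2 * π * n * u - ((n * ⌊u⌋ : ℤ) : ℝ) * (2 * π) := by
          push_cast; ring
        rw [this, Real.cos_sub_int_mul_two_pi]
      rw [this]
      simp only [mul_one]
      ring
    · have := bernoulliFun_two (Int.fract u)
      rw [bernoulliFun] at this
      simp only [mul_one]
      rw [this]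
      norm_num [Nat.factorial]
      ring
  have h3 := (hasSum_nat_add_iff' 1).mpr h2
  simpa using h3

lemma aux_piece (c : ℝ) (hc : 0 < c) :
    ∫ t in c..(c + 1), ((t - c) - (t - c) ^ 2) / t ^ 3
      = -(Real.log (c + 1) - Real.log c) + (1 / c + 1 / (c + 1)) / 2 := by
  have hpos : ∀ t ∈ Set.uIcc c (c + 1), 0 < t := by
    intro t ht
    rw [Set.uIcc_of_le (by linarith)] at ht
    exact hc.trans_le ht.1
  have c2 : IntervalIntegrable (fun t => ((t - c) - (t - c) ^ 2) / t ^ 3) volume c (c + 1) := by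
    apply ContinuousOn.intervalIntegrable
    exact ContinuousOn.div (by fun_prop) (by fun_prop) (fun t ht => (pow_pos (hpos t ht) 3).ne')
  rw [intervalIntegral.integral_eq_sub_of_hasDerivAt
    (f := fun t => -Real.log t - (2 * c + 1) * t⁻¹ + c * (c + 1) / 2 * (t ^ 2)⁻¹) _ c2]
  · have : c + 1 ≠ 0 := by positivity
    field_simp
    ring
  · intro t ht
    have ht0 := (hpos t ht).ne'
    have := (((Real.hasDerivAt_log ht0).neg).sub ((hasDerivAt_inv ht0).const_mul (2 * c + 1))).add
      (((hasDerivAt_pow 2 t).inv (pow_ne_zero 2 ht0)).const_mul (c * (c + 1) / 2))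
    convert! this using 1
    field_simp
    push_cast
    ring

lemma log_gamma_hasDerivAt (x : ℝ) (hx : 0 < x) :
    HasDerivAt (Real.log ∘ Real.Gamma) (digamma x) x := by
  have h : DifferentiableAt ℝ Real.Gamma x := Real.differentiableAt_Gamma (fun m => by
    have : (0 : ℝ) ≤ m := m.cast_nonneg
    linarith)
  exact h.hasDerivAt.log (Real.Gamma_pos_of_pos hx).ne'

lemma log_gamma_add_one (x : ℝ) (hx : 0 < x) :
    (Real.log ∘ Real.Gamma) (x + 1) = Real.log x + (Real.log ∘ Real.Gamma) x := by
  simp only [Function.comp]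
  rw [Real.Gamma_add_one hx.ne', Real.log_mul hx.ne' (Real.Gamma_pos_of_pos hx).ne']

lemma digamma_add_one (x : ℝ) (hx : 0 < x) : digamma (x + 1) = digamma x + 1 / x := by
  have h1 : HasDerivAt (fun y => (Real.log ∘ Real.Gamma) (y + 1)) (digamma (x + 1)) x :=
    (log_gamma_hasDerivAt (x + 1) (by linarith)).comp_add_const x 1
  have h2 := (Real.hasDerivAt_log hx.ne').add (log_gamma_hasDerivAt x hx)
  have h3 : HasDerivAt (fun y => (Real.log ∘ Real.Gamma) (y + 1)) (x⁻¹ + digamma x) x := by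
    refine h2.congr_of_eventuallyEq ?_
    filter_upwards [lt_mem_nhds hx] with y hy
    exact log_gamma_add_one y hy
  rw [h1.unique h3]
  ring

lemma digamma_le (x : ℝ) (hx : 0 < x) : digamma x ≤ Real.log x := by
  have := Real.convexOn_log_Gamma.le_slope_of_hasDerivAt (x := x) (y := x + 1) hx
    (by simp; linarith) (by linarith) (log_gamma_hasDerivAt x hx)
  rw [slope_def_field, log_gamma_add_one x hx] at this
  simpa using this

lemma le_digamma (x : ℝ) (hx : 0 < x) : Real.log x - 1 / x ≤ digamma x := by
  have := Real.convexOn_log_Gamma.slope_le_of_hasDerivAt (x := x) (y := x + 1) hx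
    (by simp; linarith) (by linarith) (log_gamma_hasDerivAt (x + 1) (by linarith))
  rw [slope_def_field, log_gamma_add_one x hx, digamma_add_one x hx] at this
  simp at this
  rw [one_div]
  linarith

lemma digamma_add_nat (a : ℝ) (ha : 0 < a) (N : ℕ) :
    digamma (a + N) = digamma a + ∑ k ∈ Finset.range N, 1 / (a + k) := by
  induction N with
  | zero => simp
  | succ N ih =>
    rw [Finset.sum_range_succ, Nat.cast_succ, ← add_assoc, digamma_add_one _ (by positivity), ih]
    ring

/-- The integral `∫_a^∞ ({t-a} - {t-a}²)/t³ dt` in terms of the digamma function. -/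
lemma aux_integral (a : ℝ) (ha : 0 < a) :
    ∫ t in Set.Ioi a, (Int.fract (t - a) - Int.fract (t - a) ^ 2) / t ^ 3
      = Real.log a - 1 / (2 * a) - digamma a := by
  have hint := aux_integrable a ha (fun t => Int.fract (t - a) - Int.fract (t - a) ^ 2)
    (by
      have : Measurable (fun t : ℝ => Int.fract (t - a)) :=
        measurable_fract.comp (measurable_id.sub_const a)
      exact this.sub (this.pow_const 2)) 1 (by
    intro t
    have h0 := Int.fract_nonneg (t - a)
    have h1 := (Int.fract_lt_one (t - a)).le
    rw [abs_le]
    constructor <;> nlinarith)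
  have hb : Tendsto (fun N : ℕ => a + (N : ℝ)) atTop atTop :=
    tendsto_atTop_add_const_left _ _ tendsto_natCast_atTop_atTop
  have hlim := intervalIntegral_tendsto_integral_Ioi a hint hb
  refine tendsto_nhds_unique hlim ?_
  have hval : ∀ N : ℕ, ∫ t in a..(a + N), (Int.fract (t - a) - Int.fract (t - a) ^ 2) / t ^ 3
      = (Real.log a - 1 / (2 * a) - digamma a) + (digamma (a + N) - Real.log (a + N))
        + 1 / (2 * (a + N)) := by
    intro N
    have hsum := intervalIntegral.sum_integral_adjacent_intervals (μ := volume)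
      (f := fun t : ℝ => (Int.fract (t - a) - Int.fract (t - a) ^ 2) / t ^ 3)
      (a := fun k : ℕ => a + (k : ℝ)) (n := N) (by
        intro k _
        rw [intervalIntegrable_iff_integrableOn_Ioc_of_le (by simp)]
        refine hint.mono_set ?_
        intro t ht
        have : (0 : ℝ) ≤ k := k.cast_nonneg
        exact lt_of_le_of_lt (by linarith) ht.1)
    simp only [Nat.cast_zero, add_zero] at hsum
    rw [← hsum]
    have hpiece : ∀ k : ℕ, ∫ t in (a + k)..(a + (k + 1 : ℕ)),
        (Int.fract (t - a) - Int.fract (t - a) ^ 2) / t ^ 3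
        = -(Real.log (a + k + 1) - Real.log (a + k)) + (1 / (a + k) + 1 / (a + k + 1)) / 2 := by
      intro k
      rw [← aux_piece (a + k) (by positivity)]
      rw [Nat.cast_succ, ← add_assoc]
      apply intervalIntegral.integral_congr_ae
      have hne : ∀ᵐ t : ℝ, t ≠ a + k + 1 := by
        simp [ae_iff, measure_singleton]
      filter_upwards [hne] with t hne ht
      rw [Set.uIoc_of_le (by linarith)] at ht
      have hlt : t < a + k + 1 := lt_of_le_of_ne ht.2 hne
      have : Int.fract (t - a) = t - (a + k) := by
        rw [Int.fract_eq_iff]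
        refine ⟨by linarith [ht.1], by linarith, k, ?_⟩
        push_cast
        ring
      rw [this]
    rw [Finset.sum_congr rfl (fun k _ => hpiece k), digamma_add_nat a ha]
    clear hsum hpiece
    induction N with
    | zero => simp
    | succ N ih =>
      rw [Finset.sum_range_succ, Finset.sum_range_succ, ih, Nat.cast_succ, ← add_assoc]
      have : a + N ≠ 0 := by positivity
      have : a + N + 1 ≠ 0 := by positivity
      field_simp
      ring
  have hinv : Tendsto (fun N : ℕ => (a + (N : ℝ))⁻¹) atTop (𝓝 0) := hb.inv_tendsto_atTop
  have h1 : Tendsto (fun N : ℕ => digamma (a + N) - Real.log (a + N)) atTop (𝓝 0) := by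
    refine squeeze_zero_norm (fun N => ?_) hinv
    have hp : 0 < a + (N : ℝ) := by positivity
    have := digamma_le _ hp
    have h' := le_digamma _ hp
    rw [one_div] at h'
    have : 0 < (a + (N : ℝ))⁻¹ := by positivity
    rw [Real.norm_eq_abs, abs_le]
    constructor <;> linarith
  have h2 : Tendsto (fun N : ℕ => 1 / (2 * (a + (N : ℝ)))) atTop (𝓝 0) := by
    have := hinv.const_mul (1 / 2)
    rw [mul_zero] at this
    refine this.congr (fun N => ?_)
    field_simp
  have := ((tendsto_const_nhds (x := Real.log a - 1 / (2 * a) - digamma a)).add h1).add h2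
  rw [add_zero, add_zero] at this
  exact this.congr (fun N => (hval N).symm)

lemma aux_term_scaled (a : ℝ) (ha : 0 < a) (m : ℝ) (hm : 0 < m) :
    Real.cos (2 * m * π * a) * Ci (2 * m * π * a) + Real.sin (2 * m * π * a) * si (2 * m * π * a)
      = ∫ t in Set.Ioi a,
        -(1 / (2 * π ^ 2)) * (((1 - Real.cos (2 * π * m * (t - a))) / m ^ 2) / t ^ 3) := by
  have hb : 0 < 2 * m * π := by positivity
  rw [aux_term _ (by positivity), ← integral_comp_mul_left_Ioi' _ a hb, smul_eq_mul,
    ← integral_const_mul, ← integral_const_mul, ← integral_neg]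
  refine setIntegral_congr_fun measurableSet_Ioi (fun t ht => ?_)
  have ht0 : t ≠ 0 := (ha.trans ht).ne'
  have e : 2 * m * π * t - 2 * m * π * a = 2 * π * m * (t - a) := by ring
  simp only [e]
  have := Real.pi_ne_zero
  field_simp

lemma aux_hasSum (a : ℝ) (ha : 0 < a) :
    HasSum (fun n : ℕ =>
        Real.cos (2 * ((n : ℝ) + 1) * π * a) * Ci (2 * ((n : ℝ) + 1) * π * a) +
        Real.sin (2 * ((n : ℝ) + 1) * π * a) * si (2 * ((n : ℝ) + 1) * π * a))
      (-(1 / 2) * (Real.log a - 1 / (2 * a) - digamma a)) := by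
  rw [← aux_integral a ha, ← integral_const_mul]
  simp_rw [fun n : ℕ => aux_term_scaled a ha ((n : ℝ) + 1) (by positivity)]
  have hbd : ∀ (n : ℕ) (t : ℝ),
      |(1 - Real.cos (2 * π * ((n : ℝ) + 1) * (t - a))) / ((n : ℝ) + 1) ^ 2|
        ≤ 2 * (1 / ((n : ℝ) + 1) ^ 2) := by
    intro n t
    have hp : 0 < ((n : ℝ) + 1) ^ 2 := by positivity
    rw [abs_div, abs_of_pos hp, div_eq_mul_one_div]
    refine mul_le_mul_of_nonneg_right ?_ (by positivity)
    rw [abs_le]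
    constructor <;> linarith [Real.cos_le_one (2 * π * ((n : ℝ) + 1) * (t - a)),
      Real.neg_one_le_cos (2 * π * ((n : ℝ) + 1) * (t - a))]
  have hI : ∀ n : ℕ, IntegrableOn (fun t => -(1 / (2 * π ^ 2)) *
      (((1 - Real.cos (2 * π * ((n : ℝ) + 1) * (t - a))) / ((n : ℝ) + 1) ^ 2) / t ^ 3))
      (Set.Ioi a) := fun n =>
    (aux_integrable a ha _ (by fun_prop) _ (hbd n)).const_mul _
  have h3 : IntegrableOn (fun t : ℝ => 1 / t ^ 3) (Set.Ioi a) :=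
    aux_integrable a ha (fun _ => 1) (by fun_prop) 1 (by simp)
  have hs : Summable (fun n : ℕ => 1 / ((n : ℝ) + 1) ^ 2) := by
    have := (summable_nat_add_iff 1).mpr hasSum_zeta_two.summable
    simpa using this
  have hsum : Summable (fun n : ℕ => ∫ t in Set.Ioi a, ‖-(1 / (2 * π ^ 2)) *
      (((1 - Real.cos (2 * π * ((n : ℝ) + 1) * (t - a))) / ((n : ℝ) + 1) ^ 2) / t ^ 3)‖) := by
    refine Summable.of_nonneg_of_le (fun n => integral_nonneg (fun t => norm_nonneg _))
      (fun n => ?_) (hs.mul_right ((1 / (2 * π ^ 2)) * 2 * ∫ t in Set.Ioi a, 1 / t ^ 3))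
    rw [← mul_assoc, ← integral_const_mul]
    refine setIntegral_mono_on (hI n).norm (h3.const_mul _) measurableSet_Ioi (fun t ht => ?_)
    have ht0 : 0 < t := ha.trans ht
    have hp : (0 : ℝ) < 1 / (2 * π ^ 2) := by positivity
    rw [norm_mul, norm_neg, norm_div _ (t ^ 3), Real.norm_eq_abs, Real.norm_eq_abs,
      Real.norm_eq_abs, abs_of_pos hp, abs_of_pos (pow_pos ht0 3), div_eq_mul_one_div _ (t ^ 3)]
    calc _ ≤ (1 / (2 * π ^ 2)) * ((2 * (1 / ((n : ℝ) + 1) ^ 2)) * (1 / t ^ 3)) := by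
          gcongr
          exact hbd n t
      _ = _ := by ring
  have := hasSum_integral_of_summable_integral_norm hI hsum
  convert! this using 1
  refine setIntegral_congr_fun measurableSet_Ioi (fun t ht => ?_)
  have hf := (((aux_fourier (t - a)).div_const (t ^ 3)).mul_left (-(1 / (2 * π ^ 2)))).tsum_eq
  rw [hf]
  have := Real.pi_ne_zero
  field_simp

/-- For every real `a > 0`,
`ψ(a) = log a − 1/(2a) + 2 ∑_{n=1}^∞ [cos(2nπa) Ci(2nπa) + sin(2nπa) si(2nπa)]`,
where the series converges (and the improper integrals defining `Ci`, `si` converge). -/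
theorem digamma_eq_log_sub_add_tsum_cosIntegral (a : ℝ) (ha : 0 < a) :
    (∀ x : ℝ, 0 < x →
      Tendsto (fun b : ℝ => ∫ t in x..b, Real.cos t / t) atTop (𝓝 (-Ci x))) ∧
    (∀ x : ℝ, 0 < x →
      Tendsto (fun b : ℝ => ∫ t in x..b, Real.sin t / t) atTop (𝓝 (-si x))) ∧
    ∃ S : ℝ,
      HasSum (fun n : ℕ =>
        Real.cos (2 * ((n : ℝ) + 1) * π * a) * Ci (2 * ((n : ℝ) + 1) * π * a) +
        Real.sin (2 * ((n : ℝ) + 1) * π * a) * si (2 * ((n : ℝ) + 1) * π * a)) S ∧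
      digamma a = Real.log a - 1 / (2 * a) + 2 * S := by
  refine ⟨Ci_tendsto, si_tendsto, _, aux_hasSum a ha, ?_⟩
  ring
end

section
/- The series ∑_{n=1}^∞ Ci(2nπ) converges and ∑_{n=1}^∞ Ci(2nπ) = 1/4 − γ/2, i.e. 2·∑_{n=1}^∞ Ci(2nπ) = 1/2 − γ. -/
open Real Filter MeasureTheory Topology

lemma cube_integrable {c : ℝ} (hc : 0 < c) :
    IntegrableOn (fun t : ℝ => 1 / t ^ 3) (Set.Ioi c) := by
  refine (integrableOn_Ioi_rpow_of_lt (a := -3) (by norm_num) hc).congr_fun (fun x hx => ?_)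
    measurableSet_Ioi
  have hx0 : 0 < x := hc.trans hx
  simp only
  rw [Real.rpow_neg hx0.le]
  norm_num

lemma cos_cube_integrable (a : ℝ) {c : ℝ} (hc : 0 < c) :
    IntegrableOn (fun t : ℝ => Real.cos (a * t) / t ^ 3) (Set.Ioi c) := by
  refine (cube_integrable hc).mono' (Measurable.aestronglyMeasurable (by fun_prop)) ?_
  refine (ae_restrict_iff' measurableSet_Ioi).mpr (Eventually.of_forall fun x hx => ?_)
  have hx0 : 0 < x := hc.trans hx
  rw [norm_div, Real.norm_eq_abs, Real.norm_of_nonneg (by positivity : (0:ℝ) ≤ x ^ 3)]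
  gcongr
  exact Real.abs_cos_le_one _

lemma cos_div_parts {x b : ℝ} (hx : 0 < x) (hb : x ≤ b) :
    ∫ t in x..b, Real.cos t / t = (Real.sin b / b - Real.cos b / b ^ 2)
      - (Real.sin x / x - Real.cos x / x ^ 2) - 2 * ∫ t in x..b, Real.cos (1 * t) / t ^ 3 := by
  have hpos : ∀ t ∈ Set.uIcc x b, 0 < t := by
    intro t ht
    rw [Set.uIcc_of_le hb] at ht
    exact hx.trans_le ht.1
  have i1 : IntervalIntegrable (fun t : ℝ => Real.cos t / t) volume x b :=
    ContinuousOn.intervalIntegrable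
      (Real.continuous_cos.continuousOn.div continuousOn_id fun t ht => (hpos t ht).ne')
  have i2 : IntervalIntegrable (fun t : ℝ => Real.cos (1 * t) / t ^ 3) volume x b :=
    ContinuousOn.intervalIntegrable
      (ContinuousOn.div (by fun_prop) (by fun_prop) fun t ht => (pow_pos (hpos t ht) 3).ne')
  have key : ∫ t in x..b, (Real.cos t / t + 2 * (Real.cos (1 * t) / t ^ 3)) =
      (Real.sin b / b - Real.cos b / b ^ 2) - (Real.sin x / x - Real.cos x / x ^ 2) := by
    refine intervalIntegral.integral_eq_sub_of_hasDerivAt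
      (f := fun t => Real.sin t / t - Real.cos t / t ^ 2) (fun t ht => ?_) (i1.add (i2.const_mul 2))
    have h0 := (hpos t ht).ne'
    have := ((Real.hasDerivAt_sin t).div (hasDerivAt_id t) h0).sub
      ((Real.hasDerivAt_cos t).div (hasDerivAt_pow 2 t) (pow_ne_zero 2 h0))
    refine this.congr_deriv ?_
    simp only [id, one_mul]
    field_simp
    ring
  rw [intervalIntegral.integral_add i1 (i2.const_mul 2), intervalIntegral.integral_const_mul] at key
  linarith

lemma tendsto_bdd_div {f : ℝ → ℝ} (hf : ∀ x, |f x| ≤ 1) {k : ℕ} (hk : k ≠ 0) :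
    Tendsto (fun b : ℝ => f b / b ^ k) atTop (𝓝 0) := by
  have h1 : Tendsto (fun b : ℝ => 1 / b ^ k) atTop (𝓝 0) := by
    simp only [one_div]
    exact (tendsto_pow_atTop (α := ℝ) hk).inv_tendsto_atTop
  refine squeeze_zero_norm' ?_ h1
  filter_upwards [eventually_gt_atTop 0] with x hx
  rw [norm_div, Real.norm_eq_abs, Real.norm_of_nonneg (by positivity : (0:ℝ) ≤ x ^ k)]
  gcongr
  exact hf x

lemma tendsto_cos_div {x : ℝ} (hx : 0 < x) :
    Tendsto (fun b : ℝ => ∫ t in x..b, Real.cos t / t) atTop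
      (𝓝 ((0 - 0) - (Real.sin x / x - Real.cos x / x ^ 2)
        - 2 * ∫ t in Set.Ioi x, Real.cos (1 * t) / t ^ 3)) := by
  have h1 := tendsto_bdd_div Real.abs_sin_le_one one_ne_zero
  have h2 := tendsto_bdd_div Real.abs_cos_le_one two_ne_zero
  simp only [pow_one] at h1
  have h3 := intervalIntegral_tendsto_integral_Ioi x (cos_cube_integrable 1 hx) tendsto_id
  refine (((h1.sub h2).sub_const _).sub (h3.const_mul 2)).congr' ?_
  filter_upwards [eventually_ge_atTop x] with b hb
  exact (cos_div_parts hx hb).symm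

lemma Ci_eq {x : ℝ} (hx : 0 < x) :
    Ci x = Real.sin x / x - Real.cos x / x ^ 2
      + 2 * ∫ t in Set.Ioi x, Real.cos (1 * t) / t ^ 3 := by
  rw [Ci, (tendsto_cos_div hx).limUnder_eq]
  ring

lemma Ci_two_pi (n : ℕ) :
    Ci (2 * ((n : ℝ) + 1) * π) = (1 / (4 * π ^ 2)) * (-(1 / ((n : ℝ) + 1) ^ 2)
      + 2 * ∫ u in Set.Ioi (1 : ℝ),
        1 / ((n : ℝ) + 1) ^ 2 * (Real.cos (2 * π * ((n : ℝ) + 1) * u) / u ^ 3)) := by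
  have hn : (0:ℝ) < (n : ℝ) + 1 := by positivity
  have hpi := Real.pi_pos
  set a : ℝ := 2 * ((n : ℝ) + 1) * π with ha
  have ha0 : 0 < a := by positivity
  have hc : Real.cos a = 1 := by
    rw [show a = ((n + 1 : ℕ) : ℝ) * (2 * π) by push_cast; rw [ha]; ring]
    exact Real.cos_nat_mul_two_pi _
  have hs : Real.sin a = 0 := by
    rw [show a = ((2 * (n + 1) : ℕ) : ℝ) * π by push_cast; rw [ha]]
    exact Real.sin_nat_mul_pi _
  have hsub := integral_comp_mul_left_Ioi (fun t : ℝ => Real.cos (1 * t) / t ^ 3) 1 ha0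
  rw [mul_one, smul_eq_mul] at hsub
  have h2 : ∫ t in Set.Ioi a, Real.cos (1 * t) / t ^ 3 =
      a * ∫ u in Set.Ioi (1:ℝ), Real.cos (1 * (a * u)) / (a * u) ^ 3 := by
    rw [hsub]; field_simp
  have h3 : ∫ u in Set.Ioi (1:ℝ), Real.cos (1 * (a * u)) / (a * u) ^ 3 =
      (1 / a ^ 3) * ∫ u in Set.Ioi (1:ℝ), Real.cos (2 * π * ((n : ℝ) + 1) * u) / u ^ 3 := by
    rw [← integral_const_mul]
    congr 1
    ext u
    rw [one_mul, show 2 * π * ((n : ℝ) + 1) = a by rw [ha]; ring, mul_pow]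
    field_simp
  rw [Ci_eq ha0, h2, h3, hc, hs, integral_const_mul, ha]
  field_simp
  ring

/-- Fourier series of the periodized second Bernoulli polynomial. -/
lemma fourier_b2 (u : ℝ) :
    HasSum (fun n : ℕ => 1 / ((n : ℝ) + 1) ^ 2 * Real.cos (2 * π * ((n : ℝ) + 1) * u))
      (π ^ 2 * (Int.fract u ^ 2 - Int.fract u + 1 / 6)) := by
  have h := hasSum_one_div_nat_pow_mul_cos (k := 1) one_ne_zero (x := Int.fract u)
    ⟨Int.fract_nonneg u, (Int.fract_lt_one u).le⟩
  have hb := bernoulliFun_two (Int.fract u)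
  rw [bernoulliFun] at hb
  rw [mul_one, hb, ← hasSum_nat_add_iff' 1] at h
  convert! h using 1
  · ext n
    push_cast
    congr 1
    have := Real.cos_sub_int_mul_two_pi (2 * π * ((n : ℝ) + 1) * u) (((n : ℤ) + 1) * ⌊u⌋)
    rw [← this, Int.fract]
    congr 1
    push_cast
    ring
  · norm_num [Nat.factorial]
    left
    ring

noncomputable def gB (u : ℝ) : ℝ := (Int.fract u ^ 2 - Int.fract u + 1 / 6) / u ^ 3

lemma gB_integrable : IntegrableOn gB (Set.Ioi (1:ℝ)) := by
  refine (cube_integrable one_pos).mono' ?_ ?_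
  · refine Measurable.aestronglyMeasurable ?_
    unfold gB
    have := measurable_fract (R := ℝ)
    fun_prop
  refine (ae_restrict_iff' measurableSet_Ioi).mpr (Eventually.of_forall fun x hx => ?_)
  have hx0 : (0:ℝ) < x := one_pos.trans hx
  rw [gB, norm_div, Real.norm_eq_abs, Real.norm_of_nonneg (by positivity : (0:ℝ) ≤ x ^ 3)]
  gcongr
  have h0 := Int.fract_nonneg x
  have h1 := Int.fract_lt_one x
  rw [abs_le]
  constructor <;> nlinarith

lemma gB_piece (n : ℕ) :
    IntervalIntegrable gB volume ((n:ℝ) + 1) ((n:ℝ) + 1 + 1) ∧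
    ∫ u in ((n:ℝ) + 1)..((n:ℝ) + 1 + 1), gB u =
      Real.log ((n:ℝ) + 1 + 1) - Real.log ((n:ℝ) + 1)
        - (1 / 2) * (1 / ((n:ℝ) + 1) + 1 / ((n:ℝ) + 1 + 1))
        + (1 / 12) * (1 / ((n:ℝ) + 1) ^ 2 - 1 / ((n:ℝ) + 1 + 1) ^ 2) := by
  set m : ℝ := (n:ℝ) + 1 with hm
  have hm0 : 0 < m := by positivity
  have hint : IntervalIntegrable gB volume m (m + 1) := by
    rw [intervalIntegrable_iff_integrableOn_Ioc_of_le (by linarith)]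
    refine gB_integrable.mono_set (fun x hx => ?_)
    have : (0:ℝ) ≤ n := Nat.cast_nonneg n
    have := hx.1
    simp only [Set.mem_Ioi]
    linarith
  refine ⟨hint, ?_⟩
  have hpos : ∀ t ∈ Set.uIcc m (m + 1), 0 < t := by
    intro t ht
    rw [Set.uIcc_of_le (by linarith)] at ht
    exact hm0.trans_le ht.1
  have hcongr : ∫ u in m..(m + 1), gB u =
      ∫ u in m..(m + 1), ((u - m) ^ 2 - (u - m) + 1 / 6) / u ^ 3 := by
    refine intervalIntegral.integral_congr_Ioo_of_le (by linarith) (fun u hu => ?_)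
    have hf : Int.fract u = u - m := by
      rw [Int.fract_eq_iff]
      refine ⟨by linarith [hu.1], by linarith [hu.2], (n:ℤ) + 1, ?_⟩
      push_cast
      rw [hm]; ring
    simp only [gB, hf]
  rw [hcongr, intervalIntegral.integral_eq_sub_of_hasDerivAt
    (f := fun u => Real.log u + (2 * m + 1) / u - (m ^ 2 + m + 1 / 6) / (2 * u ^ 2))]
  · field_simp
    ring
  · intro t ht
    have h0 := (hpos t ht).ne'
    have := ((Real.hasDerivAt_log h0).add
      ((hasDerivAt_const t (2 * m + 1)).div (hasDerivAt_id t) h0)).sub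
      ((hasDerivAt_const t (m ^ 2 + m + 1 / 6)).div ((hasDerivAt_pow 2 t).const_mul 2)
        (by positivity))
    refine this.congr_deriv ?_
    simp only [id]
    field_simp
    ring
  · exact ContinuousOn.intervalIntegrable
      (ContinuousOn.div (by fun_prop) (by fun_prop) fun t ht => (pow_pos (hpos t ht) 3).ne')

lemma gB_partial (N : ℕ) :
    IntervalIntegrable gB volume 1 ((N:ℝ) + 1) ∧
    ∫ u in (1:ℝ)..((N:ℝ) + 1), gB u =
      -((harmonic N : ℝ) - Real.log ((N:ℝ) + 1)) - (1 / 2) * (1 / ((N:ℝ) + 1)) + 1 / 2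
        + (1 / 12) * (1 - 1 / ((N:ℝ) + 1) ^ 2) := by
  induction N with
  | zero => simp
  | succ N ih =>
    have hp := gB_piece N
    push_cast
    refine ⟨ih.1.trans hp.1, ?_⟩
    rw [← intervalIntegral.integral_add_adjacent_intervals ih.1 hp.1, ih.2, hp.2, harmonic_succ]
    push_cast
    field_simp
    ring

lemma gB_integral :
    ∫ u in Set.Ioi (1:ℝ), gB u = 7 / 12 - Real.eulerMascheroniConstant := by
  have ht : Tendsto (fun N : ℕ => (N:ℝ) + 1) atTop atTop :=
    tendsto_atTop_add_const_right _ _ tendsto_natCast_atTop_atTop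
  have h1 := intervalIntegral_tendsto_integral_Ioi 1 gB_integrable ht
  have hi : Tendsto (fun N : ℕ => 1 / ((N:ℝ) + 1)) atTop (𝓝 0) :=
    tendsto_one_div_add_atTop_nhds_zero_nat
  have h2 := (((Real.tendsto_harmonic_sub_log_add_one.neg).sub (hi.const_mul (1 / 2))).add_const
    (1 / 2)).add (((hi.pow 2).const_sub 1).const_mul (1 / 12))
  have h3 := tendsto_nhds_unique h1 (h2.congr fun N => by rw [(gB_partial N).2, one_div_pow])
  rw [h3]
  norm_num
  ring

lemma hasSum_ints :
    HasSum (fun n : ℕ => ∫ u in Set.Ioi (1 : ℝ),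
        1 / ((n : ℝ) + 1) ^ 2 * (Real.cos (2 * π * ((n : ℝ) + 1) * u) / u ^ 3))
      (π ^ 2 * (7 / 12 - Real.eulerMascheroniConstant)) := by
  have hsq : Summable (fun n : ℕ => 1 / ((n : ℝ) + 1) ^ 2) := by
    simpa using (fourier_b2 0).summable
  have h := hasSum_integral_of_summable_integral_norm (μ := volume.restrict (Set.Ioi (1:ℝ)))
    (F := fun (n : ℕ) (u : ℝ) =>
      1 / ((n : ℝ) + 1) ^ 2 * (Real.cos (2 * π * ((n : ℝ) + 1) * u) / u ^ 3))
    (fun n => (cos_cube_integrable _ one_pos).const_mul _) ?_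
  · convert! h using 1
    rw [← gB_integral, ← integral_const_mul]
    refine setIntegral_congr_fun measurableSet_Ioi fun u _ => ?_
    have := ((fourier_b2 u).div_const (u ^ 3)).tsum_eq
    simp only [gB, ← mul_div_assoc, this]
  · refine Summable.of_nonneg_of_le (fun n => integral_nonneg fun _ => norm_nonneg _) (fun n => ?_)
      (hsq.mul_right (∫ u in Set.Ioi (1:ℝ), 1 / u ^ 3))
    rw [← integral_const_mul]
    refine setIntegral_mono_on ((cos_cube_integrable _ one_pos).const_mul _).norm
      ((cube_integrable one_pos).const_mul _) measurableSet_Ioi fun x hx => ?_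
    have hx0 : (0:ℝ) < x := one_pos.trans hx
    rw [norm_mul, norm_div (Real.cos _), Real.norm_eq_abs (Real.cos _),
      Real.norm_of_nonneg (by positivity : (0:ℝ) ≤ x ^ 3),
      Real.norm_of_nonneg (by positivity : (0:ℝ) ≤ 1 / ((n : ℝ) + 1) ^ 2)]
    gcongr
    exact Real.abs_cos_le_one _

theorem tsum_cosIntegral_two_pi_mul :
    (∀ x : ℝ, 0 < x →
      Tendsto (fun b : ℝ => ∫ t in x..b, Real.cos t / t) atTop (𝓝 (-Ci x))) ∧
    HasSum (fun n : ℕ => Ci (2 * ((n : ℝ) + 1) * π))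
      (1 / 4 - Real.eulerMascheroniConstant / 2) := by
  constructor
  · intro x hx
    have h := tendsto_cos_div hx
    rwa [Ci, neg_neg, h.limUnder_eq]
  · have hsq : HasSum (fun n : ℕ => 1 / ((n : ℝ) + 1) ^ 2) (π ^ 2 * (1 / 6)) := by
      simpa using fourier_b2 0
    have h := ((hsq.neg).add (hasSum_ints.mul_left 2)).mul_left (1 / (4 * π ^ 2))
    have hpi := Real.pi_pos
    convert! h using 1
    · ext n
      exact Ci_two_pi n
    · field_simp
      ring
end

section
/- For every real a > 0, log Γ(a) = (1/2)·log(2π) + (a − 1/2)·log a − a + (1/π)·∑_{n=1}^∞ (1/n)·[sin(2nπa)·Ci(2nπa) − cos(2nπa)·si(2nπa)], where the series on the right converges. -/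
open Real Filter MeasureTheory Topology

lemma aux_osc {F f : ℝ → ℝ} (hF : ∀ t, HasDerivAt F (f t) t) (hf : Continuous f)
    (hb : ∀ t, |F t| ≤ 1) (x : ℝ) (hx : 0 < x) :
    ∃ L, Tendsto (fun b : ℝ => ∫ t in x..b, f t / t) atTop (𝓝 L) := by
  have hFc : Continuous F := continuous_iff_continuousAt.2 fun t => (hF t).continuousAt
  have hint : IntegrableOn (fun t : ℝ => F t / t ^ 2) (Set.Ioi x) := by
    have h0 : IntegrableOn (fun t : ℝ => t ^ (-2 : ℝ)) (Set.Ioi x) :=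
      integrableOn_Ioi_rpow_of_lt (by norm_num) hx
    refine Integrable.mono' h0 ?_ ?_
    · refine ContinuousOn.aestronglyMeasurable ?_ measurableSet_Ioi
      refine hFc.continuousOn.div (by fun_prop) ?_
      intro t ht
      have : 0 < t := hx.trans ht
      positivity
    · refine (ae_restrict_iff' measurableSet_Ioi).2 (Eventually.of_forall ?_)
      intro t ht
      have h : 0 < t := hx.trans ht
      rw [Real.rpow_neg h.le, Real.rpow_two, norm_div, Real.norm_eq_abs, Real.norm_eq_abs,
        abs_of_pos (by positivity : 0 < t ^ 2), div_eq_mul_inv]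
      have : 0 < (t ^ 2)⁻¹ := by positivity
      nlinarith [hb t]
  have h1 := intervalIntegral_tendsto_integral_Ioi x hint tendsto_id
  have h2 : Tendsto (fun b : ℝ => F b / b) atTop (𝓝 0) := by
    refine squeeze_zero_norm' (a := fun b : ℝ => b⁻¹) ?_ tendsto_inv_atTop_zero
    filter_upwards [eventually_gt_atTop 0] with b hb0
    rw [norm_div, Real.norm_eq_abs, Real.norm_eq_abs, abs_of_pos hb0, div_eq_mul_inv]
    have : 0 < b⁻¹ := by positivity
    nlinarith [hb b]
  refine ⟨_, ((h2.sub_const (F x / x)).add h1).congr' ?_⟩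
  filter_upwards [eventually_ge_atTop x] with b hxb
  have hpos : ∀ t ∈ Set.uIcc x b, 0 < t := by
    intro t ht
    rw [Set.uIcc_of_le hxb] at ht
    exact hx.trans_le ht.1
  have i1 : IntervalIntegrable (fun t => f t / t) volume x b :=
    (hf.continuousOn.div continuousOn_id fun t ht => (hpos t ht).ne').intervalIntegrable
  have i2 : IntervalIntegrable (fun t => F t / t ^ 2) volume x b :=
    (hFc.continuousOn.div (by fun_prop) fun t ht =>
      (pow_pos (hpos t ht) 2).ne').intervalIntegrable
  have h3 := intervalIntegral.integral_eq_sub_of_hasDerivAt (a := x) (b := b)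
    (f := fun t => F t / t) (f' := fun t => f t / t - F t / t ^ 2) (by
      intro t ht
      have h := (hpos t ht).ne'
      convert! (hF t).div (hasDerivAt_id t) h using 1
      simp only [id]
      field_simp) (i1.sub i2)
  rw [intervalIntegral.integral_sub i1 i2] at h3
  simp only [id]
  linarith

lemma cos_series (u : ℝ) (hu : u ∈ Set.Icc (0 : ℝ) 1) :
    HasSum (fun n : ℕ => (1 - Real.cos (2 * π * ((n : ℝ) + 1) * u)) / ((n : ℝ) + 1) ^ 2)
      (π ^ 2 * (u - u ^ 2)) := by
  have h1 := hasSum_one_div_nat_pow_mul_cos (k := 1) one_ne_zero hu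
  have h2 := hasSum_zeta_two
  have e : (Polynomial.map (algebraMap ℚ ℝ) (Polynomial.bernoulli (2 * 1))).eval u
      = u ^ 2 - u + 6⁻¹ := by
    have := bernoulliFun_two u
    rwa [bernoulliFun] at this
  rw [e] at h1
  have h3 := h2.sub h1
  rw [← hasSum_nat_add_iff' 1] at h3
  convert! h3 using 1
  · ext n
    push_cast
    ring
  · simp
    ring

lemma int_J (b : ℝ) (hb : 0 < b) :
    ∫ u in (0:ℝ)..1, π ^ 2 * (u - u ^ 2) / (u + b) ^ 2
      = 2 * π ^ 2 * ((b + 1 / 2) * (Real.log (b + 1) - Real.log b) - 1) := by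
  have hpos : ∀ t ∈ Set.uIcc (0:ℝ) 1, 0 < t + b := by
    intro t ht
    rw [Set.uIcc_of_le zero_le_one] at ht
    linarith [ht.1]
  rw [intervalIntegral.integral_eq_sub_of_hasDerivAt
    (f := fun u => π ^ 2 * (-u + (2 * b + 1) * Real.log (u + b) + b * (b + 1) * (u + b)⁻¹))]
  · rw [add_comm 1 b]
    simp only [zero_add]
    field_simp
    ring
  · intro t ht
    have h := (hpos t ht).ne'
    have hd : HasDerivAt (fun u : ℝ => u + b) 1 t := (hasDerivAt_id t).add_const b
    convert! ((((hasDerivAt_id t).neg).add ((hd.log h).const_mul (2 * b + 1))).add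
      ((hd.inv h).const_mul (b * (b + 1)))).const_mul (π ^ 2) using 1
    field_simp
    ring
  · refine ContinuousOn.intervalIntegrable ?_
    exact ContinuousOn.div (by fun_prop) (by fun_prop) fun t ht => (pow_pos (hpos t ht) 2).ne'

noncomputable def hh (a : ℝ) (n k : ℕ) : ℝ :=
  ∫ u in (0:ℝ)..1, (1 - Real.cos (2 * π * ((n : ℝ) + 1) * u)) / ((n : ℝ) + 1) ^ 2
    / (u + (a + k)) ^ 2

lemma hh_nonneg (a : ℝ) (n k : ℕ) : 0 ≤ hh a n k := by
  refine intervalIntegral.integral_nonneg zero_le_one fun u _ => ?_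
  have := Real.cos_le_one (2 * π * ((n : ℝ) + 1) * u)
  have : 0 ≤ 1 - Real.cos (2 * π * ((n : ℝ) + 1) * u) := by linarith
  positivity

lemma hh_sum_n (a : ℝ) (ha : 0 < a) (k : ℕ) :
    HasSum (fun n => hh a n k)
      (2 * π ^ 2 * ((a + k + 1 / 2) * (Real.log (a + k + 1) - Real.log (a + k)) - 1)) := by
  have hb : 0 < a + k := by positivity
  rw [← int_J _ hb]
  have hs : Summable (fun n : ℕ => 2 / ((n : ℝ) + 1) ^ 2 / (a + k) ^ 2) := by
    have := (summable_nat_add_iff 1).2 hasSum_zeta_two.summable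
    have := (this.mul_left 2).mul_right (((a + k) ^ 2)⁻¹)
    refine this.congr fun n => ?_
    push_cast
    field_simp
  refine intervalIntegral.hasSum_integral_of_dominated_convergence
    (fun n _ => 2 / ((n : ℝ) + 1) ^ 2 / (a + k) ^ 2) ?_ ?_ ?_ ?_ ?_
  · intro n
    refine Measurable.aestronglyMeasurable ?_
    fun_prop
  · refine fun n => Eventually.of_forall fun t ht => ?_
    rw [Set.uIoc_of_le zero_le_one] at ht
    have h0 := ht.1
    have h1 := Real.cos_le_one (2 * π * ((n : ℝ) + 1) * t)
    have h2 := Real.neg_one_le_cos (2 * π * ((n : ℝ) + 1) * t)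
    have h3 : 0 ≤ 1 - Real.cos (2 * π * ((n : ℝ) + 1) * t) := by linarith
    rw [Real.norm_of_nonneg (by positivity)]
    have h5 : a + k ≤ t + (a + k) := by linarith
    have h6 : 1 - Real.cos (2 * π * ((n : ℝ) + 1) * t) ≤ 2 := by linarith
    exact div_le_div₀ (by positivity) (by gcongr) (by positivity)
      (pow_le_pow_left₀ hb.le h5 2)
  · exact Eventually.of_forall fun t _ => hs
  · exact intervalIntegrable_const
  · refine Eventually.of_forall fun t ht => ?_
    rw [Set.uIoc_of_le zero_le_one] at ht
    exact (cos_series t ⟨ht.1.le, ht.2⟩).div_const _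

lemma part_int (a w : ℝ) (ha : 0 < a) (hw : 0 < w) (K : ℝ) (hK : 0 ≤ K)
    (hc : Real.cos (w * K) = 1) :
    ∫ u in (0:ℝ)..K, (1 - Real.cos (w * u)) / (u + a) ^ 2
      = w * (Real.cos (w * a) * (∫ t in (w * a)..(w * K + w * a), Real.sin t / t)
        - Real.sin (w * a) * ∫ t in (w * a)..(w * K + w * a), Real.cos t / t) := by
  have hpos : ∀ t ∈ Set.uIcc (0:ℝ) K, 0 < t + a := by
    intro t ht
    rw [Set.uIcc_of_le hK] at ht
    linarith [ht.1]
  have i1 : IntervalIntegrable (fun u => (1 - Real.cos (w * u)) / (u + a) ^ 2) volume 0 K :=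
    (ContinuousOn.div (by fun_prop) (by fun_prop)
      fun t ht => (pow_pos (hpos t ht) 2).ne').intervalIntegrable
  have i2 : IntervalIntegrable (fun u => w * Real.sin (w * u) / (u + a)) volume 0 K :=
    (ContinuousOn.div (by fun_prop) (by fun_prop)
      fun t ht => (hpos t ht).ne').intervalIntegrable
  have h3 := intervalIntegral.integral_eq_sub_of_hasDerivAt (a := 0) (b := K)
    (f := fun u => -((1 - Real.cos (w * u)) / (u + a)))
    (f' := fun u => (1 - Real.cos (w * u)) / (u + a) ^ 2 - w * Real.sin (w * u) / (u + a)) (by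
      intro t ht
      have h := (hpos t ht).ne'
      have hd : HasDerivAt (fun u : ℝ => u + a) 1 t := (hasDerivAt_id t).add_const a
      have hw : HasDerivAt (fun u : ℝ => w * u) (w * 1) t := (hasDerivAt_id t).const_mul w
      convert! (((hw.cos).const_sub 1).div hd h).neg using 1
      field_simp
      ring) (i1.sub i2)
  rw [intervalIntegral.integral_sub i1 i2] at h3
  simp only [hc, mul_zero, Real.cos_zero, sub_self, zero_div, neg_zero] at h3
  rw [sub_eq_zero.1 h3]
  have h4 := intervalIntegral.smul_integral_comp_mul_add (a := 0) (b := K)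
    (fun s => Real.sin (s - w * a) / s) w (w * a)
  rw [mul_zero, zero_add] at h4
  have hp2 : ∀ t ∈ Set.uIcc (w * a) (w * K + w * a), t ≠ 0 := by
    intro t ht
    have : 0 ≤ w * K := by positivity
    have : 0 < w * a := by positivity
    rw [Set.uIcc_of_le (by linarith)] at ht
    linarith [ht.1]
  have j1 : IntervalIntegrable (fun t => Real.sin t / t) volume (w * a) (w * K + w * a) :=
    (ContinuousOn.div (by fun_prop) (by fun_prop) hp2).intervalIntegrable
  have j2 : IntervalIntegrable (fun t => Real.cos t / t) volume (w * a) (w * K + w * a) :=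
    (ContinuousOn.div (by fun_prop) (by fun_prop) hp2).intervalIntegrable
  rw [← intervalIntegral.integral_const_mul (Real.cos (w * a)),
    ← intervalIntegral.integral_const_mul (Real.sin (w * a)),
    ← intervalIntegral.integral_sub (j1.const_mul _) (j2.const_mul _)]
  have e : ∀ s : ℝ, Real.cos (w * a) * (Real.sin s / s) - Real.sin (w * a) * (Real.cos s / s)
      = Real.sin (s - w * a) / s := by
    intro s
    rw [Real.sin_sub]
    ring
  simp_rw [e]
  rw [← h4, smul_eq_mul, ← intervalIntegral.integral_const_mul,
    ← intervalIntegral.integral_const_mul]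
  refine intervalIntegral.integral_congr fun t ht => ?_
  have h := (hpos t ht).ne'
  have h' : w * t + w * a ≠ 0 := by rw [← mul_add]; exact mul_ne_zero hw.ne' h
  simp only [add_sub_cancel_right]
  field_simp

lemma hh_sum_k (a : ℝ) (ha : 0 < a) (n : ℕ) :
    HasSum (fun k => hh a n k) (2 * π * ((1 / ((n : ℝ) + 1)) *
        (Real.sin (2 * ((n : ℝ) + 1) * π * a) * Ci (2 * ((n : ℝ) + 1) * π * a) -
         Real.cos (2 * ((n : ℝ) + 1) * π * a) * si (2 * ((n : ℝ) + 1) * π * a)))) := by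
  rw [hasSum_iff_tendsto_nat_of_nonneg (hh_nonneg a n)]
  set w : ℝ := 2 * ((n : ℝ) + 1) * π with hwdef
  have hw : 0 < w := by positivity
  have hwa : 0 < w * a := by positivity
  have hcos : ∀ (k : ℕ) (u : ℝ), Real.cos (w * (u + k)) = Real.cos (w * u) := by
    intro k u
    have : w * (u + k) = w * u + ((n + 1) * k : ℕ) * (2 * π) := by
      rw [hwdef]; push_cast; ring
    rw [this, Real.cos_add_nat_mul_two_pi]
  have hk : ∀ k : ℕ, hh a n k = (1 / ((n : ℝ) + 1) ^ 2) *
      ∫ u in ((k : ℕ) : ℝ)..((k + 1 : ℕ) : ℝ), (1 - Real.cos (w * u)) / (u + a) ^ 2 := by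
    intro k
    have h := intervalIntegral.integral_comp_add_right (a := 0) (b := 1)
      (fun u => (1 - Real.cos (w * u)) / (u + a) ^ 2) (k : ℝ)
    rw [zero_add, add_comm (1:ℝ)] at h
    push_cast
    rw [← h, hh, ← intervalIntegral.integral_const_mul]
    refine intervalIntegral.integral_congr fun t ht => ?_
    simp only [hcos]
    rw [show 2 * π * ((n : ℝ) + 1) * t = w * t by rw [hwdef]; ring,
      show t + (a + k) = t + k + a by ring]
    ring
  have hsum : ∀ K : ℕ, ∑ k ∈ Finset.range K, hh a n k = (1 / ((n : ℝ) + 1) ^ 2) *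
      (w * (Real.cos (w * a) * (∫ t in (w * a)..(w * K + w * a), Real.sin t / t)
        - Real.sin (w * a) * ∫ t in (w * a)..(w * K + w * a), Real.cos t / t)) := by
    intro K
    rw [Finset.sum_congr rfl fun k _ => hk k, ← Finset.mul_sum,
      intervalIntegral.sum_integral_adjacent_intervals (a := fun k : ℕ => (k : ℝ)),
      Nat.cast_zero, part_int a w ha hw K (by positivity)]
    · simpa using hcos K 0
    · intro k _
      refine (ContinuousOn.div (by fun_prop) (by fun_prop) fun t ht => ?_).intervalIntegrable
      rw [Set.uIcc_of_le (by push_cast; linarith)] at ht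
      have h1 : (0:ℝ) ≤ k := by positivity
      have : 0 < t + a := by linarith [ht.1]
      positivity
  have ht : Tendsto (fun K : ℕ => w * (K : ℝ) + w * a) atTop atTop :=
    tendsto_atTop_add_const_right _ _ (tendsto_natCast_atTop_atTop.const_mul_atTop hw)
  have h1 := (si_tendsto _ hwa).comp ht
  have h2 := (Ci_tendsto _ hwa).comp ht
  have h3 := (((h1.const_mul (Real.cos (w * a))).sub
    (h2.const_mul (Real.sin (w * a)))).const_mul w).const_mul (1 / ((n : ℝ) + 1) ^ 2)
  convert! h3.congr fun K => (hsum K).symm using 2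
  rw [hwdef]
  field_simp
  ring

noncomputable def MM (x : ℝ) : ℝ :=
  Real.log (Real.Gamma x) - ((1 / 2) * Real.log (2 * π) + (x - 1 / 2) * Real.log x - x)

lemma log_Gamma_add_one {y : ℝ} (hy : 0 < y) :
    (Real.log ∘ Real.Gamma) (y + 1) = (Real.log ∘ Real.Gamma) y + Real.log y := by
  simp only [Function.comp]
  rw [Real.Gamma_add_one hy.ne', Real.log_mul hy.ne' (Real.Gamma_pos_of_pos hy).ne', add_comm]

lemma MM_step (x : ℝ) (hx : 0 < x) :
    MM x - MM (x + 1) = (x + 1 / 2) * (Real.log (x + 1) - Real.log x) - 1 := by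
  have := log_Gamma_add_one hx
  simp only [Function.comp] at this
  rw [MM, MM, this]
  ring

lemma MM_tendsto (a : ℝ) (ha : 0 < a) :
    Tendsto (fun n : ℕ => MM (a + n)) atTop (𝓝 0) := by
  rw [← tendsto_add_atTop_iff_nat 1]
  have h1 := (Real.BohrMollerup.tendsto_log_gamma ha).const_sub (Real.log (Real.Gamma a))
  have h2 : Tendsto (fun n => Real.log (Stirling.stirlingSeq n)) atTop (𝓝 (Real.log √π)) :=
    (Real.continuousAt_log (by positivity)).tendsto.comp Stirling.tendsto_stirlingSeq_sqrt_pi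
  have h2' := h2.sub_const (Real.log √π)
  have h3 := (Real.tendsto_mul_log_one_add_div_atTop (a + 1)).comp
    (tendsto_natCast_atTop_atTop (R := ℝ))
  have h4 : Tendsto (fun n : ℕ => Real.log (1 + (a + 1) / (n : ℝ))) atTop (𝓝 0) := by
    have : Tendsto (fun n : ℕ => 1 + (a + 1) / (n : ℝ)) atTop (𝓝 (1 + 0)) :=
      (tendsto_const_div_atTop_nhds_zero_nat (a + 1)).const_add 1
    rw [add_zero] at this
    have h := (Real.continuousAt_log one_ne_zero).tendsto.comp this
    rw [Real.log_one] at h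
    exact h
  have h5 := ((h1.add h2').sub (h3.add (h4.const_mul (a + 1 / 2)))).add_const (a + 1)
  have h6 : (Real.log (Real.Gamma a) - Real.log (Real.Gamma a) + (Real.log √π - Real.log √π) -
      (a + 1 + (a + 1 / 2) * 0) + (a + 1)) = 0 := by ring
  rw [h6] at h5
  refine h5.congr' ?_
  filter_upwards [eventually_gt_atTop 0] with n hn
  have hn' : (0:ℝ) < n := by exact_mod_cast hn
  have hG := Real.BohrMollerup.f_add_nat_eq (f := Real.log ∘ Real.Gamma)
    (fun hy => log_Gamma_add_one hy) ha (n + 1)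
  simp only [Function.comp] at hG
  have hl : Real.log (1 + (a + 1) / n) = Real.log (a + (n + 1)) - Real.log n := by
    rw [← Real.log_div (by positivity) hn'.ne']
    congr 1
    field_simp
    ring
  rw [MM, hG]
  simp only [Function.comp, Real.BohrMollerup.logGammaSeq]
  rw [Stirling.log_stirlingSeq_formula, hl, Real.log_sqrt pi_pos.le,
    Real.log_mul two_ne_zero hn'.ne', Real.log_mul two_ne_zero pi_pos.ne',
    Real.log_div hn'.ne' (Real.exp_pos 1).ne', Real.log_exp]
  push_cast
  ring

/-- For every real `a > 0`,
`log Γ(a) = (1/2) log(2π) + (a − 1/2) log a − a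
  + (1/π) ∑_{n=1}^∞ (1/n) [sin(2nπa) Ci(2nπa) − cos(2nπa) si(2nπa)]`,
the series converging (and the improper integrals defining `Ci`, `si` converging). -/
theorem log_Gamma_eq_tsum_sineIntegral (a : ℝ) (ha : 0 < a) :
    (∀ x : ℝ, 0 < x →
      Tendsto (fun b : ℝ => ∫ t in x..b, Real.cos t / t) atTop (𝓝 (-Ci x))) ∧
    (∀ x : ℝ, 0 < x →
      Tendsto (fun b : ℝ => ∫ t in x..b, Real.sin t / t) atTop (𝓝 (-si x))) ∧
    ∃ S : ℝ,
      HasSum (fun n : ℕ => (1 / ((n : ℝ) + 1)) *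
        (Real.sin (2 * ((n : ℝ) + 1) * π * a) * Ci (2 * ((n : ℝ) + 1) * π * a) -
         Real.cos (2 * ((n : ℝ) + 1) * π * a) * si (2 * ((n : ℝ) + 1) * π * a))) S ∧
      Real.log (Real.Gamma a) =
        (1 / 2) * Real.log (2 * π) + (a - 1 / 2) * Real.log a - a + (1 / π) * S := by
  refine ⟨Ci_tendsto, si_tendsto, π * MM a, ?_, ?_⟩
  · have hJ : HasSum (fun k : ℕ => 2 * π ^ 2 *
        ((a + k + 1 / 2) * (Real.log (a + k + 1) - Real.log (a + k)) - 1)) (2 * π ^ 2 * MM a) := by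
      rw [hasSum_iff_tendsto_nat_of_nonneg]
      · have h := ((MM_tendsto a ha).const_sub (MM a)).const_mul (2 * π ^ 2)
        rw [sub_zero] at h
        refine h.congr fun K => ?_
        rw [← Finset.mul_sum]
        congr 1
        have := Finset.sum_range_sub' (fun k : ℕ => MM (a + k)) K
        simp only [Nat.cast_zero, add_zero] at this
        rw [← this]
        refine Finset.sum_congr rfl fun k _ => ?_
        rw [← MM_step (a + k) (by positivity)]
        push_cast
        ring_nf
      · intro k
        exact (hh_sum_n a ha k).nonneg fun n => hh_nonneg a n k
    have hs : Summable (fun p : ℕ × ℕ => hh a p.2 p.1) := by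
      refine (summable_prod_of_nonneg fun p => hh_nonneg a p.2 p.1).2
        ⟨fun k => (hh_sum_n a ha k).summable, ?_⟩
      exact hJ.summable.congr fun k => (hh_sum_n a ha k).tsum_eq.symm
    have e1 : ∑' p : ℕ × ℕ, hh a p.2 p.1 = 2 * π ^ 2 * MM a :=
      (hs.hasSum.prod_fiberwise fun k => hh_sum_n a ha k).unique hJ
    have h2 : HasSum (fun p : ℕ × ℕ => hh a p.1 p.2) (2 * π ^ 2 * MM a) := by
      rw [← e1]
      exact (Equiv.prodComm ℕ ℕ).hasSum_iff.2 hs.hasSum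
    have h3 := (h2.prod_fiberwise fun n => hh_sum_k a ha n).mul_left (1 / (2 * π))
    convert! h3 using 1
    · ext n
      field_simp
    · field_simp
  · rw [MM]
    field_simp
    ring
end

section
/- For every positive integer n, the improper integral ∫_0^∞ [ψ(1+u) − log u]·cos(2nπu) du converges and equals (1/2)·[ψ(1+n) − log n]. -/
open Real Filter MeasureTheory Topology

open Set

lemma dg_hasDerivAt {x : ℝ} (hx : 0 < x) : HasDerivAt (log ∘ Gamma) (digamma x) x := by
  have h1 : DifferentiableAt ℝ Gamma x := Real.differentiableAt_Gamma (fun m => by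
    have : (0:ℝ) ≤ m := Nat.cast_nonneg m
    linarith)
  exact h1.hasDerivAt.log (Real.Gamma_pos_of_pos hx).ne'

lemma dg_add_one {x : ℝ} (hx : 0 < x) : digamma (1 + x) = digamma x + 1 / x := by
  have h1 : HasDerivAt (fun y => (log ∘ Gamma) (1 + y)) (digamma (1 + x)) x :=
    HasDerivAt.comp_const_add 1 x (dg_hasDerivAt (by linarith))
  have h2 : HasDerivAt (fun y => (log ∘ Gamma) y + log y) (digamma x + 1 / x) x := by
    have := (dg_hasDerivAt hx).add (Real.hasDerivAt_log hx.ne')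
    rw [one_div]; exact this
  refine h1.unique (h2.congr_of_eventuallyEq ?_)
  filter_upwards [lt_mem_nhds hx] with y hy
  simp only [Function.comp]
  rw [add_comm 1 y, Real.Gamma_add_one hy.ne', Real.log_mul hy.ne' (Real.Gamma_pos_of_pos hy).ne']
  ring

lemma dg_bounds {x : ℝ} (hx : 0 < x) :
    0 ≤ digamma (1 + x) - log x ∧ digamma (1 + x) - log x ≤ 1 / x := by
  have hs : slope (log ∘ Gamma) x (1 + x) = log x := by
    rw [slope_def_field]
    simp only [Function.comp]
    rw [add_comm 1 x, Real.Gamma_add_one hx.ne',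
      Real.log_mul hx.ne' (Real.Gamma_pos_of_pos hx).ne']
    ring
  have h1 := Real.convexOn_log_Gamma.le_slope_of_hasDerivAt (x := x) (y := 1 + x) hx
    (by simp only [mem_Ioi]; linarith) (by linarith) (dg_hasDerivAt hx)
  have h2 := Real.convexOn_log_Gamma.slope_le_of_hasDerivAt (x := x) (y := 1 + x) hx
    (by simp only [mem_Ioi]; linarith) (by linarith) (dg_hasDerivAt (by linarith))
  rw [hs] at h1 h2
  have h3 := dg_add_one hx
  constructor <;> linarith

noncomputable def gK (t : ℝ) : ℝ := 1 / t - 1 / (exp t - 1)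

lemma gK_meas : Measurable gK := by unfold gK; fun_prop

lemma gK_nonneg {t : ℝ} (ht : 0 < t) : 0 ≤ gK t := by
  unfold gK
  have := Real.add_one_le_exp t
  have : 1 / (exp t - 1) ≤ 1 / t := one_div_le_one_div_of_le ht (by linarith)
  linarith

lemma gK_mul_le {t : ℝ} (ht : 0 < t) : gK t * t ≤ 1 := by
  have h : 0 < exp t - 1 := by have := Real.add_one_le_exp t; linarith
  have : gK t * t = 1 - t / (exp t - 1) := by unfold gK; field_simp
  rw [this]
  have : 0 ≤ t / (exp t - 1) := by positivity
  linarith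

lemma gK_le_one {t : ℝ} (ht : 0 < t) : gK t ≤ 1 := by
  have h : 0 < exp t - 1 := by have := Real.add_one_le_exp t; linarith
  have h2 := Real.add_one_le_exp (-t)
  have h3 : exp t * exp (-t) = 1 := by rw [← Real.exp_add]; simp
  have h4 : exp t * (-t + 1) ≤ 1 := by
    exact (mul_le_mul_of_nonneg_left h2 (Real.exp_pos t).le).trans h3.le
  unfold gK
  rw [div_sub_div _ _ ht.ne' h.ne', div_le_one (by positivity)]
  nlinarith

lemma intble {f : ℝ → ℝ} (hm : Measurable f) (C : ℝ)
    (h : ∀ t, 0 < t → |f t| ≤ C * (1 + t ^ 2)⁻¹) : IntegrableOn f (Ioi 0) := by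
  refine Integrable.mono' (integrable_inv_one_add_sq.integrableOn.const_mul C)
    hm.aestronglyMeasurable ?_
  filter_upwards [ae_restrict_mem measurableSet_Ioi] with t ht
  exact h t ht

lemma const_seq {h : ℕ → ℝ} (h1 : ∀ n, h (n + 1) = h n) (h2 : Tendsto h atTop (𝓝 0)) :
    h 0 = 0 := by
  have : ∀ n, h n = h 0 := by
    intro n
    induction n with
    | zero => rfl
    | succ k ih => rw [h1, ih]
  exact tendsto_nhds_unique (tendsto_const_nhds.congr (fun n => (this n).symm)) h2

lemma gexp_int {u : ℝ} (hu : 0 < u) : IntegrableOn (fun t => gK t * exp (-u * t)) (Ioi 0) := by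
  refine Integrable.mono' (integrableOn_exp_mul_Ioi (a := -u) (by linarith) 0)
    (by have := gK_meas; fun_prop) ?_
  filter_upwards [ae_restrict_mem measurableSet_Ioi] with t ht
  rw [Real.norm_of_nonneg (mul_nonneg (gK_nonneg ht) (Real.exp_pos _).le)]
  exact mul_le_of_le_one_left (Real.exp_pos _).le (gK_le_one ht)

noncomputable def Bf (u : ℝ) : ℝ := ∫ t in Ioi 0, gK t * exp (-u * t)

lemma Bf_nonneg {u : ℝ} : 0 ≤ Bf u :=
  setIntegral_nonneg measurableSet_Ioi
    (fun _ ht => mul_nonneg (gK_nonneg ht) (Real.exp_pos _).le)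

lemma Bf_le {u : ℝ} (hu : 0 < u) : Bf u ≤ 1 / u := by
  have h := integral_exp_mul_Ioi (a := -u) (by linarith) 0
  have : Bf u ≤ ∫ t in Ioi 0, exp (-u * t) :=
    setIntegral_mono_on (gexp_int hu) (integrableOn_exp_mul_Ioi (a := -u) (by linarith) 0)
      measurableSet_Ioi
      (fun t ht => mul_le_of_le_one_left (Real.exp_pos _).le (gK_le_one ht))
  rw [h] at this
  simpa using this

lemma Bf_diff {u : ℝ} (hu : 0 < u) : Bf u - Bf (u + 1) = log ((u + 1) / u) - 1 / (u + 1) := by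
  have e1 : Bf u - Bf (u + 1) =
      ∫ t in Ioi 0, (gK t * exp (-u * t) - gK t * exp (-(u + 1) * t)) :=
    (integral_sub (gexp_int hu) (gexp_int (by linarith))).symm
  have key : ∀ t : ℝ, 0 < t → t⁻¹ • (exp (-(u * t)) - exp (-((u + 1) * t))) =
      (gK t * exp (-u * t) - gK t * exp (-(u + 1) * t)) + exp (-(u + 1) * t) := by
    intro t ht
    have h : exp t - 1 ≠ 0 := by have := Real.add_one_le_exp t; linarith
    have h2 : exp (-u * t) = exp t * exp (-(u + 1) * t) := by
      rw [← Real.exp_add]; ring_nf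
    rw [← neg_mul, ← neg_mul, h2]
    unfold gK
    simp only [smul_eq_mul]
    field_simp
    ring
  have hi1 : IntegrableOn (fun t => gK t * exp (-u * t) - gK t * exp (-(u + 1) * t)) (Ioi 0) :=
    (gexp_int hu).sub (gexp_int (by linarith))
  have hi2 : IntegrableOn (fun t : ℝ => exp (-(u + 1) * t)) (Ioi 0) :=
    integrableOn_exp_mul_Ioi (a := -(u + 1)) (by linarith) 0
  have hi : IntegrableOn (fun t : ℝ => t⁻¹ • (exp (-(u * t)) - exp (-((u + 1) * t)))) (Ioi 0) :=
    (hi1.add hi2).congr_fun (fun t ht => (key t ht).symm) measurableSet_Ioi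
  have hF := Frullani.integral_Ioi_eq (f := fun x : ℝ => exp (-x)) (a := u) (b := u + 1)
    (L := 1) (R := 0)
    ((by fun_prop : Continuous fun x : ℝ => exp (-x)).locallyIntegrable.locallyIntegrableOn _)
    hu (by linarith)
    (by
      have : Tendsto (fun x : ℝ => exp (-x)) (𝓝 0) (𝓝 (exp (-0))) :=
        (by fun_prop : Continuous fun x : ℝ => exp (-x)).tendsto 0
      simp only [neg_zero, exp_zero] at this
      exact this.mono_left nhdsWithin_le_nhds)
    Real.tendsto_exp_neg_atTop_nhds_zero hi
  rw [setIntegral_congr_fun measurableSet_Ioi (fun t ht => key t ht),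
    integral_add hi1 hi2, ← e1, integral_exp_mul_Ioi (by linarith) 0] at hF
  have e2 : -exp (-(u + 1) * 0) / (-(u + 1)) = 1 / (u + 1) := by
    rw [mul_zero, exp_zero, neg_div_neg_eq]
  rw [e2] at hF
  simp only [sub_zero, smul_eq_mul, mul_one] at hF
  linarith

lemma digamma_eq_Bf {u : ℝ} (hu : 0 < u) : digamma (1 + u) - log u = Bf u := by
  have := const_seq (h := fun k : ℕ => digamma (1 + (u + k)) - log (u + k) - Bf (u + k)) ?_ ?_
  · simp at this; linarith
  · intro k
    have hk : 0 < u + k := by positivity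
    have h1 := Bf_diff hk
    have h2 := dg_add_one (x := u + k + 1) (by linarith)
    rw [Real.log_div (by linarith) hk.ne'] at h1
    push_cast
    rw [← add_assoc u, h2]
    rw [add_comm (u + k) 1] at *
    linarith
  · have ht : Tendsto (fun k : ℕ => 1 / (u + k)) atTop (𝓝 0) := by
      simp only [one_div]
      exact (tendsto_atTop_add_const_left _ u tendsto_natCast_atTop_atTop).inv_tendsto_atTop
    have h1 : Tendsto (fun k : ℕ => digamma (1 + (u + k)) - log (u + k)) atTop (𝓝 0) :=
      squeeze_zero (fun k => (dg_bounds (by positivity)).1)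
        (fun k => (dg_bounds (by positivity)).2) ht
    have h2 : Tendsto (fun k : ℕ => Bf (u + k)) atTop (𝓝 0) :=
      squeeze_zero (fun k => Bf_nonneg) (fun k => Bf_le (by positivity)) ht
    simpa using h1.sub h2

lemma inner_int {a t : ℝ} (ht : 0 < t) (b : ℝ) :
    ∫ u in (0:ℝ)..b, exp (-u * t) * cos (a * u) =
      (t - exp (-b * t) * (t * cos (a * b) - a * sin (a * b))) / (t ^ 2 + a ^ 2) := by
  have hp : t ^ 2 + a ^ 2 ≠ 0 := by positivity
  have := intervalIntegral.integral_eq_sub_of_hasDerivAt (a := 0) (b := b)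
    (f := fun u => exp (-u * t) * (a * sin (a * u) - t * cos (a * u)) / (t ^ 2 + a ^ 2))
    (f' := fun u => exp (-u * t) * cos (a * u)) (fun u _ => by
      have h1 : HasDerivAt (fun u : ℝ => exp (-u * t)) (exp (-u * t) * (-1 * t)) u :=
        (((hasDerivAt_id u).neg).mul_const t).exp
      have h0 : HasDerivAt (fun u : ℝ => a * u) a u := by
        simpa using (hasDerivAt_id u).const_mul a
      have h2 := ((h0.sin.const_mul a).sub (h0.cos.const_mul t))
      have h3 := (h1.mul h2).div_const (t ^ 2 + a ^ 2)
      refine h3.congr_deriv ?_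
      simp only [Pi.sub_apply]
      field_simp
      ring)
    (Continuous.intervalIntegrable (by fun_prop) _ _)
  rw [this]
  simp
  field_simp
  ring

lemma exp_int {t : ℝ} (ht : 0 < t) (b : ℝ) :
    ∫ u in (0:ℝ)..b, exp (-u * t) = (1 - exp (-b * t)) / t := by
  have := inner_int (a := 0) ht b
  simp at this
  simp only [neg_mul]
  rw [this]
  field_simp

lemma prod_int (a : ℝ) {b : ℝ} (hb : 0 < b) :
    Integrable (Function.uncurry fun u t : ℝ => gK t * exp (-u * t) * cos (a * u))
      ((volume.restrict (uIoc 0 b)).prod (volume.restrict (Ioi 0))) := by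
  have hm := gK_meas
  have hM : Measurable (Function.uncurry fun u t : ℝ => gK t * exp (-u * t) * cos (a * u)) := by
    unfold Function.uncurry
    fun_prop
  rw [integrable_prod_iff' hM.aestronglyMeasurable]
  constructor
  · refine Eventually.of_forall fun t => ?_
    have : Continuous fun u : ℝ => gK t * exp (-u * t) * cos (a * u) := by fun_prop
    have h := this.intervalIntegrable (μ := volume) 0 b
    rw [intervalIntegrable_iff] at h
    exact h
  · refine Integrable.mono' (integrable_inv_one_add_sq.integrableOn.const_mul (b + 1))
      hM.norm.aestronglyMeasurable.prod_swap.integral_prod_right' ?_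
    filter_upwards [ae_restrict_mem measurableSet_Ioi] with t ht
    have ht' : 0 < t := ht
    rw [Real.norm_of_nonneg (integral_nonneg fun _ => norm_nonneg _)]
    have hg := gK_nonneg ht'
    have h1 : ∫ u in uIoc 0 b, ‖Function.uncurry
        (fun u t : ℝ => gK t * exp (-u * t) * cos (a * u)) (u, t)‖ ≤
        ∫ u in uIoc 0 b, gK t * exp (-u * t) := by
      refine integral_mono_of_nonneg (Eventually.of_forall fun _ => norm_nonneg _) ?_
        (Eventually.of_forall fun u => ?_)
      · have : Continuous fun u : ℝ => gK t * exp (-u * t) := by fun_prop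
        have h := this.intervalIntegrable (μ := volume) 0 b
        rw [intervalIntegrable_iff] at h
        exact h
      · simp only [Function.uncurry, norm_mul, Real.norm_eq_abs, abs_of_nonneg hg, Real.abs_exp]
        exact mul_le_of_le_one_right (by positivity) (Real.abs_cos_le_one _)
    refine h1.trans ?_
    rw [uIoc_of_le hb.le, ← intervalIntegral.integral_of_le hb.le,
      intervalIntegral.integral_const_mul, exp_int ht']
    have e1 : 1 - exp (-b * t) ≤ b * t := by
      have := Real.add_one_le_exp (-b * t); linarith
    have e2 : 1 - exp (-b * t) ≤ 1 := by
      have := Real.exp_pos (-b * t); linarith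
    have e3 : 0 ≤ 1 - exp (-b * t) := by
      have : exp (-b * t) ≤ 1 := Real.exp_le_one_iff.mpr (by nlinarith)
      linarith
    rw [← div_eq_mul_inv, le_div_iff₀ (by positivity), ← mul_div_assoc, div_mul_eq_mul_div,
      div_le_iff₀ ht']
    have f1 : gK t * (1 - exp (-b * t)) ≤ b * t := by
      calc gK t * (1 - exp (-b * t)) ≤ 1 * (b * t) :=
            mul_le_mul (gK_le_one ht') e1 e3 zero_le_one
        _ = _ := one_mul _
    have f2 : gK t * t * (1 - exp (-b * t)) ≤ 1 * 1 :=
      mul_le_mul (gK_mul_le ht') e2 e3 zero_le_one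
    nlinarith

noncomputable def Ff (a : ℝ) : ℝ := ∫ t in Ioi 0, gK t * (t / (t ^ 2 + a ^ 2))

lemma main_lim {a : ℝ} (ha : 1 ≤ a) :
    Tendsto (fun b : ℝ => ∫ u in (0:ℝ)..b, (digamma (1 + u) - log u) * cos (a * u)) atTop
      (𝓝 (Ff a)) := by
  have hm := gK_meas
  have e1 : ∀ᶠ b : ℝ in atTop, ∫ t in Ioi 0, gK t *
      ((t - exp (-b * t) * (t * cos (a * b) - a * sin (a * b))) / (t ^ 2 + a ^ 2)) =
      ∫ u in (0:ℝ)..b, (digamma (1 + u) - log u) * cos (a * u) := by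
    filter_upwards [eventually_gt_atTop 0] with b hb
    have h1 : ∫ u in (0:ℝ)..b, (digamma (1 + u) - log u) * cos (a * u) =
        ∫ u in (0:ℝ)..b, ∫ t in Ioi 0, gK t * exp (-u * t) * cos (a * u) := by
      refine intervalIntegral.integral_congr_ae (Eventually.of_forall fun u hu => ?_)
      rw [uIoc_of_le hb.le] at hu
      rw [digamma_eq_Bf hu.1, integral_mul_const]
      rfl
    rw [h1, intervalIntegral_integral_swap (prod_int a hb)]
    refine setIntegral_congr_fun measurableSet_Ioi fun t ht => ?_
    simp only [mul_assoc]
    rw [intervalIntegral.integral_const_mul, inner_int ht]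
  refine Tendsto.congr' e1 ?_
  refine tendsto_integral_filter_of_dominated_convergence (fun t => (2 + a) * (1 + t ^ 2)⁻¹)
    (Eventually.of_forall fun b => by
      apply Measurable.aestronglyMeasurable; fun_prop) ?_
    (integrable_inv_one_add_sq.integrableOn.const_mul _) ?_
  · filter_upwards [eventually_gt_atTop 0] with b hb
    filter_upwards [ae_restrict_mem measurableSet_Ioi] with t ht
    have ht' : 0 < t := ht
    have hg := gK_nonneg ht'
    have hE : exp (-b * t) ≤ 1 := Real.exp_le_one_iff.mpr (by nlinarith)
    have hE0 := Real.exp_pos (-b * t)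
    have hN : |t - exp (-b * t) * (t * cos (a * b) - a * sin (a * b))| ≤ 2 * t + a := by
      have c1 : |t * cos (a * b)| ≤ t := by
        rw [abs_mul, abs_of_pos ht']
        exact mul_le_of_le_one_right ht'.le (Real.abs_cos_le_one _)
      have c2 : |a * sin (a * b)| ≤ a := by
        rw [abs_mul, abs_of_pos (by linarith : 0 < a)]
        exact mul_le_of_le_one_right (by linarith) (Real.abs_sin_le_one _)
      have c3 : |exp (-b * t) * (t * cos (a * b) - a * sin (a * b))| ≤ t + a := by
        rw [abs_mul, abs_of_pos hE0]
        refine (mul_le_of_le_one_left (abs_nonneg _) hE).trans ?_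
        exact (abs_sub _ _).trans (add_le_add c1 c2)
      have := abs_sub t (exp (-b * t) * (t * cos (a * b) - a * sin (a * b)))
      rw [abs_of_pos ht'] at this
      linarith
    rw [Real.norm_eq_abs, abs_mul, abs_of_nonneg hg, abs_div,
      abs_of_pos (by positivity : 0 < t ^ 2 + a ^ 2), ← mul_div_assoc, ← div_eq_mul_inv]
    have h1 := gK_mul_le ht'
    have h2 := gK_le_one ht'
    apply div_le_div₀ (by linarith) _ (by positivity) (by nlinarith)
    calc _ ≤ gK t * (2 * t + a) := mul_le_mul_of_nonneg_left hN hg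
      _ ≤ 2 + a := by nlinarith
  · filter_upwards [ae_restrict_mem measurableSet_Ioi] with t ht
    have ht' : 0 < t := ht
    refine Tendsto.const_mul _ (Tendsto.div_const ?_ _)
    have h0 : Tendsto (fun b : ℝ => exp (-b * t)) atTop (𝓝 0) := by
      have : Tendsto (fun b : ℝ => b * t) atTop atTop := tendsto_id.atTop_mul_const ht'
      refine (Real.tendsto_exp_neg_atTop_nhds_zero.comp this).congr fun b => ?_
      simp only [Function.comp, neg_mul]
    have h1 : Tendsto (fun b : ℝ => exp (-b * t) * (t * cos (a * b) - a * sin (a * b)))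
        atTop (𝓝 0) := by
      refine h0.zero_mul_isBoundedUnder_le ?_
      refine isBoundedUnder_of ⟨t + a, fun b => ?_⟩
      simp only [Function.comp, Real.norm_eq_abs]
      have c1 : |t * cos (a * b)| ≤ t := by
        rw [abs_mul, abs_of_pos ht']
        exact mul_le_of_le_one_right ht'.le (Real.abs_cos_le_one _)
      have c2 : |a * sin (a * b)| ≤ a := by
        rw [abs_mul, abs_of_pos (by linarith : 0 < a)]
        exact mul_le_of_le_one_right (by linarith) (Real.abs_sin_le_one _)
      exact (abs_sub _ _).trans (add_le_add c1 c2)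
    simpa using tendsto_const_nhds.sub h1

lemma gK_series {t : ℝ} (ht : 0 < t) :
    ∑' k : ℕ, 2 * t / (t ^ 2 + (2 * π * (k + 1)) ^ 2) = 1 / 2 - gK t := by
  have hpi := Real.pi_pos
  have hpiC : (π : ℂ) ≠ 0 := by exact_mod_cast hpi.ne'
  have htC : (t : ℂ) ≠ 0 := by exact_mod_cast ht.ne'
  set z : ℂ := Complex.I * t / (2 * π) with hz
  have hzim : z.im = t / (2 * π) := by
    have : z = Complex.I * ((t / (2 * π) : ℝ) : ℂ) := by
      rw [hz]; push_cast; ring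
    rw [this, Complex.I_mul_im, Complex.ofReal_re]
  have hzc : z ∈ Complex.integerComplement := by
    rw [Complex.mem_integerComplement_iff]
    rintro ⟨m, hm⟩
    have := congrArg Complex.im hm
    rw [hzim, Complex.intCast_im] at this
    have h2 : 0 < t / (2 * π) := by positivity
    linarith
  have h := cot_series_rep' hzc
  have hterm : ∀ k : ℕ, 1 / (z - (k + 1)) + 1 / (z + (k + 1)) =
      (-(2 * π) * Complex.I) * ((2 * t / (t ^ 2 + (2 * π * (k + 1)) ^ 2) : ℝ) : ℂ) := by
    intro k
    have hp : (t : ℂ) ^ 2 + (2 * π * (k + 1)) ^ 2 ≠ 0 := by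
      have : 0 < t ^ 2 + (2 * π * (k + 1)) ^ 2 := by positivity
      exact_mod_cast this.ne'
    have h1 : z + (k + 1) ≠ 0 := by
      simpa using Complex.integerComplement_add_ne_zero hzc (k + 1)
    have h2 : z - (k + 1) ≠ 0 := by
      have := Complex.integerComplement_add_ne_zero hzc (-(k + 1))
      push_cast at this
      rwa [← sub_eq_add_neg] at this
    have h3 : (z - (k + 1)) * (z + (k + 1)) =
        -((t : ℂ) ^ 2 + (2 * π * (k + 1)) ^ 2) / (2 * π) ^ 2 := by
      rw [hz]; field_simp; ring_nf; rw [Complex.I_sq]; ring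
    have h4 : 1 / (z - (k + 1)) + 1 / (z + (k + 1)) = 2 * z / ((z - (k + 1)) * (z + (k + 1))) := by
      field_simp; ring
    rw [h4, h3, hz]
    push_cast
    field_simp
  simp_rw [hterm] at h
  rw [tsum_mul_left, ← Complex.ofReal_tsum, Complex.cot_pi_eq_exp_ratio] at h
  have hexp : Complex.exp (2 * π * Complex.I * z) = (exp (-t) : ℝ) := by
    push_cast
    congr 1
    rw [hz]; field_simp; rw [Complex.I_sq]
  rw [hexp] at h
  have hE : exp (-t) < 1 := by rw [← Real.exp_zero]; exact Real.exp_lt_exp.mpr (by linarith)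
  have hE1 : (1 : ℂ) - (exp (-t) : ℝ) ≠ 0 := by
    have : (1 - exp (-t)) ≠ 0 := by linarith
    exact_mod_cast this
  set S := ∑' k : ℕ, 2 * t / (t ^ 2 + (2 * π * (k + 1)) ^ 2)
  have h5 : (S : ℂ) = ((1 / 2 * ((exp (-t) + 1) / (1 - exp (-t))) - 1 / t : ℝ) : ℂ) := by
    have hI : (-(2 * π) * Complex.I) ≠ 0 := by simp [hpi.ne']
    apply mul_left_cancel₀ hI
    rw [← h, hz]
    push_cast at hE1 ⊢
    have hI0 := Complex.I_ne_zero
    field_simp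
    simp only [Complex.I_sq]
    ring
  have h6 : S = 1 / 2 * ((exp (-t) + 1) / (1 - exp (-t))) - 1 / t := by exact_mod_cast h5
  rw [h6]
  unfold gK
  have hx : exp t - 1 ≠ 0 := by have := Real.add_one_le_exp t; linarith
  rw [Real.exp_neg]
  have := Real.exp_pos t
  have hE2 : 1 - (exp t)⁻¹ ≠ 0 := by rw [← Real.exp_neg]; linarith
  have e : ((exp t)⁻¹ + 1) / (1 - (exp t)⁻¹) = (1 + exp t) / (exp t - 1) := by
    rw [div_eq_div_iff hE2 hx]; field_simp
  rw [e]
  field_simp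
  ring

lemma arctan_lim {a : ℝ} (ha : 0 < a) : Tendsto (fun t : ℝ => arctan (t / a)) atTop (𝓝 (π / 2)) :=
  (tendsto_nhds_of_tendsto_nhdsWithin tendsto_arctan_atTop).comp
    (tendsto_id.atTop_div_const ha)

lemma arctan_deriv {a : ℝ} (ha : 0 < a) (t : ℝ) :
    HasDerivAt (fun t : ℝ => arctan (t / a)) (a / (t ^ 2 + a ^ 2)) t := by
  have h := ((hasDerivAt_id t).div_const a).arctan
  refine h.congr_deriv ?_
  simp only [id]
  field_simp
  ring

lemma rat_int {a c : ℝ} (ha : 0 < a) (hc : 0 < c) :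
    IntegrableOn (fun t : ℝ => t ^ 2 / ((t ^ 2 + a ^ 2) * (t ^ 2 + c ^ 2))) (Ioi 0) ∧
    ∫ t in Ioi 0, t ^ 2 / ((t ^ 2 + a ^ 2) * (t ^ 2 + c ^ 2)) = π / (2 * (a + c)) := by
  have hpos : ∀ x ∈ Ioi (0:ℝ), 0 ≤ x ^ 2 / ((x ^ 2 + a ^ 2) * (x ^ 2 + c ^ 2)) :=
    fun x _ => by positivity
  by_cases hac : a = c
  · subst hac
    have hd : ∀ x ∈ Ici (0:ℝ), HasDerivAt
        (fun t : ℝ => (arctan (t / a) / a - t / (t ^ 2 + a ^ 2)) / 2)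
        (x ^ 2 / ((x ^ 2 + a ^ 2) * (x ^ 2 + a ^ 2))) x := by
      intro x _
      have hp : x ^ 2 + a ^ 2 ≠ 0 := by positivity
      have h1 : HasDerivAt (fun t : ℝ => t ^ 2 + a ^ 2) (2 * x) x := by
        simpa using (hasDerivAt_pow 2 x).add_const (a ^ 2)
      refine ((((arctan_deriv ha x).div_const a).sub
        ((hasDerivAt_id x).div h1 hp)).div_const 2).congr_deriv ?_
      simp only [id]
      field_simp
      ring
    have h0 : Tendsto (fun t : ℝ => t / (t ^ 2 + a ^ 2)) atTop (𝓝 0) := by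
      refine squeeze_zero' (g := fun t : ℝ => t⁻¹) ?_ ?_ tendsto_inv_atTop_zero
      · filter_upwards [eventually_gt_atTop 0] with t ht
        positivity
      · filter_upwards [eventually_gt_atTop 0] with t ht
        rw [div_le_iff₀ (by positivity)]
        field_simp
        nlinarith [sq_nonneg a]
    have hl := (((arctan_lim ha).div_const a).sub h0).div_const 2
    refine ⟨integrableOn_Ioi_deriv_of_nonneg' hd hpos hl, ?_⟩
    rw [integral_Ioi_of_hasDerivAt_of_nonneg' hd hpos hl]
    simp
    field_simp
    ring
  · have hs : a ^ 2 - c ^ 2 ≠ 0 := by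
      intro h
      apply hac
      have : (a - c) * (a + c) = 0 := by linarith
      rcases mul_eq_zero.mp this with h | h <;> linarith
    have hd : ∀ x ∈ Ici (0:ℝ), HasDerivAt
        (fun t : ℝ => (a * arctan (t / a) - c * arctan (t / c)) / (a ^ 2 - c ^ 2))
        (x ^ 2 / ((x ^ 2 + a ^ 2) * (x ^ 2 + c ^ 2))) x := by
      intro x _
      have hp : x ^ 2 + a ^ 2 ≠ 0 := by positivity
      have hp : x ^ 2 + c ^ 2 ≠ 0 := by positivity
      refine ((((arctan_deriv ha x).const_mul a).sub
        ((arctan_deriv hc x).const_mul c)).div_const _).congr_deriv ?_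
      field_simp
      ring
    have hl := (((arctan_lim ha).const_mul a).sub ((arctan_lim hc).const_mul c)).div_const
      (a ^ 2 - c ^ 2)
    refine ⟨integrableOn_Ioi_deriv_of_nonneg' hd hpos hl, ?_⟩
    rw [integral_Ioi_of_hasDerivAt_of_nonneg' hd hpos hl]
    simp
    have : a + c ≠ 0 := by positivity
    rw [div_eq_div_iff hs (by positivity)]
    ring

lemma log_int {a b : ℝ} (ha : 0 < a) (hab : a ≤ b) :
    IntegrableOn (fun t : ℝ => t / (t ^ 2 + a ^ 2) - t / (t ^ 2 + b ^ 2)) (Ioi 0) ∧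
    ∫ t in Ioi 0, (t / (t ^ 2 + a ^ 2) - t / (t ^ 2 + b ^ 2)) = log (b / a) := by
  have hb : 0 < b := by linarith
  have hpos : ∀ x ∈ Ioi (0:ℝ), 0 ≤ x / (x ^ 2 + a ^ 2) - x / (x ^ 2 + b ^ 2) := by
    intro x hx
    have hx' : 0 < x := hx
    have : x / (x ^ 2 + b ^ 2) ≤ x / (x ^ 2 + a ^ 2) := by gcongr
    linarith
  have hd : ∀ x ∈ Ici (0:ℝ), HasDerivAt
      (fun t : ℝ => (log (t ^ 2 + a ^ 2) - log (t ^ 2 + b ^ 2)) / 2)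
      (x / (x ^ 2 + a ^ 2) - x / (x ^ 2 + b ^ 2)) x := by
    intro x _
    have h1 : ∀ c : ℝ, HasDerivAt (fun t : ℝ => t ^ 2 + c ^ 2) (2 * x) x := fun c => by
      simpa using (hasDerivAt_pow 2 x).add_const (c ^ 2)
    refine ((((h1 a).log (by positivity)).sub ((h1 b).log (by positivity))).div_const
      2).congr_deriv ?_
    ring
  have hl : Tendsto (fun t : ℝ => (log (t ^ 2 + a ^ 2) - log (t ^ 2 + b ^ 2)) / 2) atTop
      (𝓝 0) := by
    have h2 : Tendsto (fun t : ℝ => (a ^ 2 - b ^ 2) / (t ^ 2 + b ^ 2)) atTop (𝓝 0) :=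
      Tendsto.const_div_atTop
        (tendsto_atTop_add_const_right _ _ (tendsto_pow_atTop two_ne_zero)) _
    have h3 : Tendsto (fun t : ℝ => log (1 + (a ^ 2 - b ^ 2) / (t ^ 2 + b ^ 2)) / 2) atTop
        (𝓝 (log (1 + 0) / 2)) :=
      ((h2.const_add 1).log (by norm_num)).div_const 2
    simp only [add_zero, log_one, zero_div] at h3
    refine h3.congr fun t => ?_
    rw [← Real.log_div (by positivity) (by positivity)]
    congr 2
    field_simp
    ring
  refine ⟨integrableOn_Ioi_deriv_of_nonneg' hd hpos hl, ?_⟩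
  rw [integral_Ioi_of_hasDerivAt_of_nonneg' hd hpos hl, Real.log_div hb.ne' ha.ne']
  simp
  ring

lemma Ff_int {a : ℝ} (ha : 1 ≤ a) : IntegrableOn (fun t => gK t * (t / (t ^ 2 + a ^ 2))) (Ioi 0) := by
  have hm := gK_meas
  refine intble (by fun_prop) 1 fun t ht => ?_
  have hg := gK_nonneg ht
  rw [abs_of_nonneg (by positivity), one_mul, ← mul_div_assoc, inv_eq_one_div]
  exact div_le_div₀ zero_le_one (gK_mul_le ht) (by positivity) (by nlinarith)

lemma Ff_nonneg (a : ℝ) : 0 ≤ Ff a :=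
  setIntegral_nonneg measurableSet_Ioi fun t ht => by
    have ht' : 0 < t := ht
    have := gK_nonneg ht'
    positivity

lemma Ff_le {a : ℝ} (ha : 1 ≤ a) : Ff a ≤ π / 2 / a := by
  have ha0 : 0 < a := by linarith
  have hd : ∀ x ∈ Ici (0:ℝ), HasDerivAt (fun t : ℝ => arctan (t / a) / a)
      (1 / (x ^ 2 + a ^ 2)) x := fun x _ =>
    ((arctan_deriv ha0 x).div_const a).congr_deriv (by field_simp)
  have hpos : ∀ x ∈ Ioi (0:ℝ), 0 ≤ 1 / (x ^ 2 + a ^ 2) := fun x _ => by positivity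
  have hl := (arctan_lim ha0).div_const a
  have h1 := integral_Ioi_of_hasDerivAt_of_nonneg' hd hpos hl
  have : Ff a ≤ ∫ t in Ioi 0, 1 / (t ^ 2 + a ^ 2) :=
    setIntegral_mono_on (Ff_int ha) (integrableOn_Ioi_deriv_of_nonneg' hd hpos hl)
      measurableSet_Ioi fun t ht => by
        rw [← mul_div_assoc]
        have := gK_mul_le ht
        gcongr
  rw [h1] at this
  simpa using this

lemma tele (x : ℝ) (hx : 0 < x) :
    HasSum (fun k : ℕ => 1 / (x + k) - 1 / (x + (k + 1))) (1 / x) := by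
  rw [hasSum_iff_tendsto_nat_of_nonneg]
  · have h := fun n => Finset.sum_range_sub' (fun k : ℕ => 1 / (x + (k : ℝ))) n
    push_cast at h
    simp_rw [h]
    have ht : Tendsto (fun k : ℕ => 1 / (x + k)) atTop (𝓝 0) := by
      simp only [one_div]
      exact (tendsto_atTop_add_const_left _ x tendsto_natCast_atTop_atTop).inv_tendsto_atTop
    simpa using tendsto_const_nhds.sub ht
  · intro k
    have : 1 / (x + (k + 1)) ≤ 1 / (x + k) := by
      apply one_div_le_one_div_of_le <;> first | positivity | linarith
    linarith

lemma Ff_diff {x : ℝ} (hx : 1 ≤ x) :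
    Ff (2 * π * x) - Ff (2 * π * (x + 1)) = (log ((x + 1) / x) - 1 / (x + 1)) / 2 := by
  have hpi := Real.pi_pos
  have hpi3 := Real.pi_gt_three
  have hx0 : 0 < x := by linarith
  set a := 2 * π * x with ha
  set b := 2 * π * (x + 1) with hb
  have ha1 : 1 ≤ a := by nlinarith
  have hab : a ≤ b := by nlinarith
  have ha0 : 0 < a := by linarith
  have hb0 : 0 < b := by linarith
  obtain ⟨hL1, hL2⟩ := log_int ha0 hab
  set K : ℝ → ℝ := fun t => t / (t ^ 2 + a ^ 2) - t / (t ^ 2 + b ^ 2) with hK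
  have e1 : Ff a - Ff b = ∫ t in Ioi 0, gK t * K t := by
    unfold Ff
    rw [← integral_sub (Ff_int ha1) (Ff_int (ha1.trans hab))]
    simp only [hK, mul_sub]
  have hgK : IntegrableOn (fun t => gK t * K t) (Ioi 0) := by
    have := (Ff_int ha1).sub (Ff_int (ha1.trans hab))
    refine this.congr_fun (fun t _ => ?_) measurableSet_Ioi
    simp only [hK, mul_sub, Pi.sub_apply]
  let G : ℕ → ℝ → ℝ := fun k t => 2 * t / (t ^ 2 + (2 * π * (k + 1)) ^ 2) * K t
  have hG : ∀ k : ℕ, G k = fun t =>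
      2 * (t ^ 2 / ((t ^ 2 + a ^ 2) * (t ^ 2 + (2 * π * (k + 1)) ^ 2)) -
        t ^ 2 / ((t ^ 2 + b ^ 2) * (t ^ 2 + (2 * π * (k + 1)) ^ 2))) := by
    intro k
    funext t
    simp only [G, hK]
    have : 0 < 2 * π * ((k:ℝ) + 1) := by positivity
    field_simp
  have hck : ∀ k : ℕ, 0 < 2 * π * ((k:ℝ) + 1) := fun k => by positivity
  have hGi : ∀ k, IntegrableOn (G k) (Ioi 0) := by
    intro k
    rw [hG]
    exact ((rat_int ha0 (hck k)).1.sub (rat_int hb0 (hck k)).1).const_mul 2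
  have hGv : ∀ k : ℕ, ∫ t in Ioi 0, G k t =
      1 / 2 * (1 / (x + 1 + k) - 1 / (x + 1 + (k + 1))) := by
    intro k
    rw [hG, integral_const_mul, integral_sub (rat_int ha0 (hck k)).1 (rat_int hb0 (hck k)).1,
      (rat_int ha0 (hck k)).2, (rat_int hb0 (hck k)).2, ha, hb]
    have e1 : 2 * π * x + 2 * π * ((k:ℝ) + 1) = 2 * π * (x + 1 + k) := by ring
    have e2 : 2 * π * (x + 1) + 2 * π * ((k:ℝ) + 1) = 2 * π * (x + 1 + (k + 1)) := by ring
    rw [e1, e2]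
    have : 0 < x + 1 + k := by positivity
    have : 0 < x + 1 + (k + 1) := by positivity
    field_simp
  have hKn : ∀ t ∈ Ioi (0:ℝ), 0 ≤ K t := by
    intro t ht
    have ht' : 0 < t := ht
    have : t / (t ^ 2 + b ^ 2) ≤ t / (t ^ 2 + a ^ 2) := by gcongr
    simp only [hK]
    linarith
  have hGn : ∀ k : ℕ, ∫ t in Ioi 0, ‖G k t‖ = ∫ t in Ioi 0, G k t := by
    intro k
    refine setIntegral_congr_fun measurableSet_Ioi fun t ht => ?_
    have h1 := hKn t ht
    have ht' : 0 < t := ht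
    exact Real.norm_of_nonneg (by simp only [G]; positivity)
  have hT := (tele (x + 1) (by linarith)).mul_left (1 / 2)
  have hS := hasSum_integral_of_summable_integral_norm (μ := volume.restrict (Ioi 0)) hGi
    (by simp_rw [hGn, hGv]; exact hT.summable)
  simp_rw [hGv] at hS
  have hS2 := hS.unique hT
  have e2 : ∫ t in Ioi 0, ∑' k, G k t = ∫ t in Ioi 0, (1 / 2 * K t - gK t * K t) := by
    refine setIntegral_congr_fun measurableSet_Ioi fun t ht => ?_
    simp only [G]
    rw [tsum_mul_right, gK_series ht]
    ring
  rw [e2, integral_sub (hL1.const_mul _) hgK, integral_const_mul, hL2, ← e1] at hS2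
  have e3 : b / a = (x + 1) / x := by
    rw [ha, hb]; field_simp
  rw [e3] at hS2
  linarith

lemma Ff_eq (n : ℕ) (hn : 0 < n) :
    Ff (2 * π * n) = (digamma (1 + (n : ℝ)) - log n) / 2 := by
  have hpi3 := Real.pi_gt_three
  have hn1 : (1:ℝ) ≤ n := by exact_mod_cast hn
  have := const_seq (h := fun k : ℕ => Ff (2 * π * (n + k)) -
    (digamma (1 + ((n:ℝ) + k)) - log (n + k)) / 2) ?_ ?_
  · simp at this; linarith
  · intro k
    have hk0 : (0:ℝ) ≤ k := Nat.cast_nonneg k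
    have hk : 0 < (n:ℝ) + k := by linarith
    have h1 := Ff_diff (x := n + k) (by linarith)
    have h2 := dg_add_one (x := (n:ℝ) + k + 1) (by linarith)
    rw [Real.log_div (by linarith) hk.ne'] at h1
    push_cast
    rw [← add_assoc (n:ℝ), h2]
    rw [add_comm 1 ((n:ℝ) + k)]
    linarith
  · have ht : Tendsto (fun k : ℕ => 1 / ((n:ℝ) + k)) atTop (𝓝 0) := by
      simp only [one_div]
      exact (tendsto_atTop_add_const_left _ _ tendsto_natCast_atTop_atTop).inv_tendsto_atTop
    have hp : ∀ k : ℕ, 1 ≤ (n:ℝ) + k := fun k => by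
      have hk0 : (0:ℝ) ≤ k := Nat.cast_nonneg k
      linarith
    have h1 : Tendsto (fun k : ℕ => digamma (1 + ((n:ℝ) + k)) - log (n + k)) atTop (𝓝 0) :=
      squeeze_zero (fun k => (dg_bounds (by linarith [hp k])).1)
        (fun k => (dg_bounds (by linarith [hp k])).2) ht
    have h2 : Tendsto (fun k : ℕ => Ff (2 * π * (n + k))) atTop (𝓝 0) := by
      refine squeeze_zero (fun k => Ff_nonneg _) (fun k => ?_) ht
      refine (Ff_le (by nlinarith [hp k])).trans ?_
      have := hp k
      rw [div_le_div_iff₀ (by nlinarith) (by linarith)]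
      nlinarith [Real.pi_pos]
    simpa using h2.sub (h1.div_const 2)

/-- Ramanujan's integral: for every positive integer `n`, the improper integral
`∫_0^∞ [ψ(1+u) − log u] cos(2nπu) du` converges and equals `(1/2)[ψ(1+n) − log n]`. -/
theorem integral_digamma_sub_log_mul_cos (n : ℕ) (hn : 0 < n) :
    Tendsto (fun b : ℝ =>
        ∫ u in (0 : ℝ)..b, (digamma (1 + u) - Real.log u) * Real.cos (2 * (n : ℝ) * π * u))
      atTop (𝓝 ((digamma (1 + (n : ℝ)) - Real.log (n : ℝ)) / 2)) := by
  have hn1 : (1:ℝ) ≤ n := by exact_mod_cast hn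
  have h := main_lim (a := 2 * π * n) (by nlinarith [Real.pi_gt_three])
  rw [Ff_eq n hn] at h
  have e : 2 * (n:ℝ) * π = 2 * π * n := by ring
  rw [e]
  exact h
end

section
/- The series ∑_{n=1}^∞ [ψ(n) − log n + 1/(2n)] converges and ∑_{n=1}^∞ [ψ(n) − log n + 1/(2n)] = (1/2)·(1 + γ − log(2π)). -/
open Real Filter MeasureTheory Topology

lemma trap_aux (m : ℝ) (hm : 0 < m) :
    Real.log (m + 1) - Real.log m ≤ 1 / m + 1 / (2 * (m + 1)) - 1 / (2 * m) := by
  rw [← Real.log_div (by positivity) (by positivity)]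
  have h1 : 0 ≤ Real.log ((m + 1) / m) := by
    apply Real.log_nonneg
    rw [le_div_iff₀ hm]
    linarith
  have h2 := Real.self_le_sinh_iff.mpr h1
  rw [Real.sinh_log (by positivity)] at h2
  refine h2.trans (le_of_eq ?_)
  field_simp
  ring

lemma mid_aux (m : ℝ) (hm : 0 < m) :
    1 / (m + 1) ≤ Real.log (m + 1 + 1 / 2) - Real.log (m + 1 / 2) := by
  rw [← Real.log_div (by positivity) (by positivity)]
  have h := Real.le_log_one_add_of_nonneg (x := 1 / (m + 1 / 2)) (by positivity)
  have e : 1 + 1 / (m + 1 / 2) = (m + 1 + 1 / 2) / (m + 1 / 2) := by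
    field_simp
    ring
  rw [e] at h
  refine le_trans (le_of_eq ?_) h
  field_simp
  ring

lemma harm_upper (n : ℕ) (hn : 0 < n) :
    (harmonic n : ℝ) - Real.log n - 1 / (2 * n) ≤ Real.eulerMascheroniConstant := by
  have hmono : Monotone (fun k : ℕ => (harmonic (k + 1) : ℝ) - Real.log ((k + 1 : ℕ) : ℝ)
      - 1 / (2 * ((k + 1 : ℕ) : ℝ))) := by
    apply monotone_nat_of_le_succ
    intro k
    have := trap_aux ((k : ℝ) + 1) (by positivity)
    rw [harmonic_succ (k + 1)]
    push_cast
    have e : ((k : ℝ) + 1 + 1)⁻¹ = 2 * (1 / (2 * ((k : ℝ) + 1 + 1))) := by field_simp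
    have e' : 1 / ((k : ℝ) + 1) = 2 * (1 / (2 * ((k : ℝ) + 1))) := by field_simp
    rw [e]
    linarith
  have hl : Tendsto (fun k : ℕ => (harmonic k : ℝ) - Real.log (k : ℝ)
      - 1 / (2 * (k : ℝ))) atTop (𝓝 (Real.eulerMascheroniConstant - 0)) := by
    refine Real.tendsto_harmonic_sub_log.sub ?_
    have := (tendsto_one_div_atTop_nhds_zero_nat (𝕜 := ℝ)).const_mul (1 / 2)
    rw [mul_zero] at this
    refine this.congr fun k => ?_
    rw [one_div_mul_one_div]
  rw [sub_zero] at hl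
  have := hmono.ge_of_tendsto ((tendsto_add_atTop_iff_nat 1).mpr hl) (n - 1)
  simpa [Nat.sub_add_cancel hn] using this

lemma harm_lower (n : ℕ) (hn : 0 < n) :
    Real.eulerMascheroniConstant + 1 / (2 * n + 1) ≤ (harmonic n : ℝ) - Real.log n := by
  have hanti : Antitone (fun k : ℕ => (harmonic (k + 1) : ℝ) -
      Real.log (((k + 1 : ℕ) : ℝ) + 1 / 2)) := by
    apply antitone_nat_of_succ_le
    intro k
    have := mid_aux ((k : ℝ) + 1) (by positivity)
    rw [harmonic_succ (k + 1)]
    push_cast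
    rw [← one_div]
    linarith
  have hl : Tendsto (fun k : ℕ => (harmonic k : ℝ) - Real.log ((k : ℝ) + 1 / 2))
      atTop (𝓝 Real.eulerMascheroniConstant) := by
    refine tendsto_of_tendsto_of_tendsto_of_le_of_le' Real.tendsto_harmonic_sub_log_add_one
      Real.tendsto_harmonic_sub_log ?_ ?_
    · refine Eventually.of_forall fun k => ?_
      have : Real.log ((k : ℝ) + 1 / 2) ≤ Real.log ((k : ℝ) + 1) :=
        Real.log_le_log (by positivity) (by linarith)
      linarith
    · filter_upwards [eventually_gt_atTop 0] with k hk
      have hk' : (0 : ℝ) < k := by exact_mod_cast hk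
      have : Real.log (k : ℝ) ≤ Real.log ((k : ℝ) + 1 / 2) :=
        Real.log_le_log (by positivity) (by linarith)
      linarith
  have h := hanti.le_of_tendsto ((tendsto_add_atTop_iff_nat 1).mpr hl) (n - 1)
  simp only [Nat.sub_add_cancel hn] at h
  have hn' : (0 : ℝ) < n := by exact_mod_cast hn
  have h2 := Real.one_sub_inv_le_log_of_pos (x := ((n : ℝ) + 1 / 2) / n) (by positivity)
  rw [Real.log_div (by positivity) (by positivity)] at h2
  have e : 1 - (((n : ℝ) + 1 / 2) / n)⁻¹ = 1 / (2 * n + 1) := by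
    field_simp
    ring
  rw [e] at h2
  linarith

lemma tendsto_mul_aux :
    Tendsto (fun n : ℕ => (n : ℝ) * ((harmonic n : ℝ) - Real.log n - Real.eulerMascheroniConstant))
      atTop (𝓝 (1 / 2)) := by
  have h1 : Tendsto (fun n : ℕ => (n : ℝ) * (1 / (2 * n + 1))) atTop (𝓝 (1 / 2)) := by
    refine Stirling.tendsto_self_div_two_mul_self_add_one.congr fun n => ?_
    ring
  refine tendsto_of_tendsto_of_tendsto_of_le_of_le' h1 tendsto_const_nhds ?_ ?_
  · filter_upwards [eventually_gt_atTop 0] with n hn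
    have := harm_lower n hn
    gcongr
    linarith
  · filter_upwards [eventually_gt_atTop 0] with n hn
    have h := harm_upper n hn
    have hn' : (0 : ℝ) < n := by exact_mod_cast hn
    have : (n : ℝ) * ((harmonic n : ℝ) - Real.log n - Real.eulerMascheroniConstant)
        ≤ n * (1 / (2 * n)) := by
      gcongr
      linarith
    refine this.trans (le_of_eq ?_)
    field_simp

lemma digamma_nat (n : ℕ) :
    digamma ((n : ℝ) + 1) = (harmonic n : ℝ) - Real.eulerMascheroniConstant := by
  unfold digamma
  rw [Real.deriv_Gamma_nat, Real.Gamma_nat_eq_factorial]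
  have : (n.factorial : ℝ) ≠ 0 := by positivity
  field_simp
  ring

lemma partial_sum (N : ℕ) :
    ∑ n ∈ Finset.range N,
      (digamma ((n : ℝ) + 1) - Real.log ((n : ℝ) + 1) + 1 / (2 * ((n : ℝ) + 1))) =
    N * (harmonic N : ℝ) - N - N * Real.eulerMascheroniConstant - Real.log (N.factorial)
      + (harmonic N : ℝ) / 2 := by
  induction N with
  | zero => simp
  | succ N ih =>
    rw [Finset.sum_range_succ, ih, digamma_nat, harmonic_succ, Nat.factorial_succ]
    have : (N.factorial : ℝ) ≠ 0 := by positivity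
    push_cast
    rw [Real.log_mul (by positivity) this]
    field_simp
    ring

/-- `∑_{n=1}^∞ [ψ(n) − log n + 1/(2n)] = (1/2)(1 + γ − log(2π))`, the series converging. -/
theorem tsum_digamma_sub_log_add_inv :
    HasSum (fun n : ℕ =>
        digamma ((n : ℝ) + 1) - Real.log ((n : ℝ) + 1) + 1 / (2 * ((n : ℝ) + 1)))
      ((1 / 2) * (1 + Real.eulerMascheroniConstant - Real.log (2 * π))) := by
  have hS : Tendsto (fun N : ℕ => ∑ n ∈ Finset.range N,
      (digamma ((n : ℝ) + 1) - Real.log ((n : ℝ) + 1) + 1 / (2 * ((n : ℝ) + 1)))) atTop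
      (𝓝 ((1 / 2) * (1 + Real.eulerMascheroniConstant - Real.log (2 * π)))) := by
    have hst := Stirling.tendsto_stirlingSeq_sqrt_pi.log (by positivity)
    have h := ((tendsto_mul_aux.add (Real.tendsto_harmonic_sub_log.div_const 2)).sub hst).sub_const
      (Real.log 2 / 2)
    have e : 1 / 2 + Real.eulerMascheroniConstant / 2 - Real.log √π - Real.log 2 / 2 =
        (1 / 2) * (1 + Real.eulerMascheroniConstant - Real.log (2 * π)) := by
      rw [Real.log_sqrt Real.pi_pos.le, Real.log_mul two_ne_zero Real.pi_ne_zero]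
      ring
    rw [e] at h
    refine h.congr' ?_
    filter_upwards [eventually_gt_atTop 0] with N hN
    have hN' : (N : ℝ) ≠ 0 := by positivity
    rw [partial_sum, Stirling.log_stirlingSeq_formula, Real.log_mul two_ne_zero hN',
      Real.log_div hN' (Real.exp_ne_zero 1), Real.log_exp]
    ring
  have hneg : HasSum (fun n : ℕ =>
        -(digamma ((n : ℝ) + 1) - Real.log ((n : ℝ) + 1) + 1 / (2 * ((n : ℝ) + 1))))
      (-((1 / 2) * (1 + Real.eulerMascheroniConstant - Real.log (2 * π)))) := by
    rw [hasSum_iff_tendsto_nat_of_nonneg]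
    · simpa only [Finset.sum_neg_distrib] using hS.neg
    · intro n
      have h := harm_upper (n + 1) n.succ_pos
      rw [harmonic_succ] at h
      rw [digamma_nat]
      push_cast at h
      have e : ((n : ℝ) + 1)⁻¹ = 2 * (1 / (2 * ((n : ℝ) + 1))) := by field_simp
      rw [e] at h
      linarith
  simpa only [neg_neg] using hneg.neg
end

section
/- The series ∑_{n=1}^∞ [ψ(n) − log n + (1/2)·ψ'(n)] converges and ∑_{n=1}^∞ [ψ(n) − log n + (1/2)·ψ'(n)] = 1 + γ/2 − (1/2)·log(2π). -/
open Real Filter MeasureTheory Topology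

lemma my_contDiffAt_Gamma {x : ℝ} (hx : 0 < x) : ContDiffAt ℝ 2 Real.Gamma x := by
  have h : ContDiffAt ℂ 2 Complex.Gamma (x : ℂ) := by
    have hd : DifferentiableOn ℂ Complex.Gamma {z : ℂ | 0 < z.re} := by
      intro z hz
      refine (Complex.differentiableAt_Gamma z ?_).differentiableWithinAt
      intro m hm
      have h1 : 0 < z.re := hz
      rw [hm] at h1
      simp at h1
      have : (0 : ℝ) ≤ m := Nat.cast_nonneg m
      linarith
    have ho : IsOpen {z : ℂ | 0 < z.re} := isOpen_lt continuous_const Complex.continuous_re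
    exact (hd.contDiffOn ho).contDiffAt (ho.mem_nhds (by simpa using hx))
  have h2 := h.real_of_complex
  exact h2

lemma my_digamma_contDiffAt {x : ℝ} (hx : 0 < x) : DifferentiableAt ℝ digamma x := by
  have h := my_contDiffAt_Gamma hx
  have h1 : DifferentiableAt ℝ (deriv Real.Gamma) x := by
    have h2 : ContDiffAt ℝ 1 (fderiv ℝ Real.Gamma) x := h.fderiv_right (by norm_num)
    exact (h2.differentiableAt (by norm_num)).clm_apply (differentiableAt_const (1 : ℝ))
  exact h1.div (h.differentiableAt (by norm_num)) (Real.Gamma_pos_of_pos hx).ne'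

lemma my_diffGamma {x : ℝ} (hx : 0 < x) : DifferentiableAt ℝ Real.Gamma x :=
  (my_contDiffAt_Gamma hx).differentiableAt (by norm_num)

lemma my_digamma_add_one {x : ℝ} (hx : 0 < x) : digamma (x + 1) = digamma x + 1 / x := by
  have hG := (Real.Gamma_pos_of_pos hx).ne'
  have h1 : deriv Real.Gamma (x + 1) = Real.Gamma x + x * deriv Real.Gamma x := by
    rw [← deriv_comp_add_const]
    have he : (fun y : ℝ => Real.Gamma (y + 1)) =ᶠ[𝓝 x] fun y => y * Real.Gamma y := by
      filter_upwards [eventually_gt_nhds hx] with y hy using Real.Gamma_add_one hy.ne'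
    rw [he.deriv_eq]
    have := (hasDerivAt_id x).mul (my_diffGamma hx).hasDerivAt
    have h3 := this.deriv
    simp only [id, one_mul] at h3
    exact h3
  unfold digamma
  rw [h1, Real.Gamma_add_one hx.ne']
  field_simp
  ring

lemma my_deriv_digamma_add_one {x : ℝ} (hx : 0 < x) :
    deriv digamma (x + 1) = deriv digamma x - 1 / x ^ 2 := by
  rw [← deriv_comp_add_const]
  have he : (fun y : ℝ => digamma (y + 1)) =ᶠ[𝓝 x] fun y => digamma y + y⁻¹ := by
    filter_upwards [eventually_gt_nhds hx] with y hy
    rw [my_digamma_add_one hy, one_div]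
  rw [he.deriv_eq]
  rw [((my_digamma_contDiffAt hx).hasDerivAt.fun_add (hasDerivAt_inv hx.ne')).deriv]
  ring

lemma my_digamma_mono : MonotoneOn digamma (Set.Ioi 0) := by
  have h := Real.convexOn_log_Gamma.monotoneOn_deriv (fun x hx =>
    ((my_diffGamma hx).log (Real.Gamma_pos_of_pos hx).ne'))
  intro x hx y hy hxy
  have := h hx hy hxy
  simp only [Function.comp_def] at this
  rwa [deriv.log (my_diffGamma hx) (Real.Gamma_pos_of_pos hx).ne',
    deriv.log (my_diffGamma hy) (Real.Gamma_pos_of_pos hy).ne'] at this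

lemma my_trigamma_nonneg {x : ℝ} (hx : 0 < x) : 0 ≤ deriv digamma x := by
  have h := (my_digamma_contDiffAt hx).hasDerivAt.tendsto_slope_zero_right
  refine ge_of_tendsto h ?_
  filter_upwards [self_mem_nhdsWithin] with t ht
  have ht' : 0 < t := ht
  have := my_digamma_mono (Set.mem_Ioi.2 hx) (Set.mem_Ioi.2 (by linarith : 0 < x + t)) (by linarith)
  simp only [smul_eq_mul]
  exact mul_nonneg (by positivity) (by linarith)

lemma my_slope_le {x h : ℝ} (hx : 1 < x) (h0 : 0 < h) (h1 : h ≤ 1) :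
    digamma (x + h) - digamma x ≤ h / (x - 1) := by
  let D : ℕ → ℝ := fun n => digamma (x + n + h) - digamma (x + n) - h / (x + n - 1)
  have hmono : Monotone D := by
    refine monotone_nat_of_le_succ fun n => ?_
    simp only [D]
    have hn : (0 : ℝ) ≤ n := Nat.cast_nonneg n
    push_cast
    rw [show x + ((n : ℝ) + 1) + h = (x + n + h) + 1 by ring,
      show x + ((n : ℝ) + 1) = (x + n) + 1 by ring, my_digamma_add_one (by linarith),
      my_digamma_add_one (by linarith)]
    generalize hy : x + (n : ℝ) = y
    have hy1 : 1 < y := by linarith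
    have e : 1 / (y + h) - 1 / y - h / (y + 1 - 1) + h / (y - 1)
        = h * (1 + h) / (y * (y + h) * (y - 1)) := by
      have : y - 1 ≠ 0 := by linarith
      have : y + h ≠ 0 := by linarith
      have : y ≠ 0 := by linarith
      rw [add_sub_cancel_right]
      field_simp
      ring
    have : 0 ≤ h * (1 + h) / (y * (y + h) * (y - 1)) := by
      have : 0 < y - 1 := by linarith
      have : 0 < y := by linarith
      positivity
    linarith
  have hx1 : Tendsto (fun n : ℕ => x + (n : ℝ)) atTop atTop :=
    tendsto_atTop_add_const_left _ _ tendsto_natCast_atTop_atTop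
  have hx2 : Tendsto (fun n : ℕ => x + (n : ℝ) - 1) atTop atTop :=
    tendsto_atTop_add_const_right _ _ hx1
  have hlim : Tendsto D atTop (𝓝 0) := by
    have a1 : Tendsto (fun n : ℕ => digamma (x + n + h) - digamma (x + n)) atTop (𝓝 0) := by
      refine squeeze_zero (g := fun n : ℕ => 1 / (x + n)) ?_ ?_ ?_
      · intro n
        have hn : (0 : ℝ) ≤ n := Nat.cast_nonneg n
        exact sub_nonneg.2 (my_digamma_mono (Set.mem_Ioi.2 (by linarith))
          (Set.mem_Ioi.2 (by linarith)) (by linarith))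
      · intro n
        have hn : (0 : ℝ) ≤ n := Nat.cast_nonneg n
        have := my_digamma_mono (a := x + n + h) (b := x + n + 1) (Set.mem_Ioi.2 (by linarith))
          (Set.mem_Ioi.2 (by linarith)) (by linarith)
        rw [my_digamma_add_one (by linarith)] at this
        linarith
      · exact tendsto_const_nhds.div_atTop hx1
    have a2 : Tendsto (fun n : ℕ => h / (x + n - 1)) atTop (𝓝 0) :=
      tendsto_const_nhds.div_atTop hx2
    simpa using a1.sub a2
  have := hmono.ge_of_tendsto hlim 0
  simp only [D, Nat.cast_zero, add_zero] at this
  linarith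

lemma my_trigamma_le {x : ℝ} (hx : 1 < x) : deriv digamma x ≤ 1 / (x - 1) := by
  have h := (my_digamma_contDiffAt (by linarith : 0 < x)).hasDerivAt.tendsto_slope_zero_right
  refine le_of_tendsto h ?_
  filter_upwards [Ioc_mem_nhdsGT (zero_lt_one' ℝ)] with t ht
  have := my_slope_le hx ht.1 ht.2
  have ht0 := ht.1
  rw [smul_eq_mul, inv_mul_le_iff₀ ht0]
  rwa [mul_one_div]

lemma my_trigamma_tendsto : Tendsto (fun n : ℕ => deriv digamma ((n : ℝ) + 1)) atTop (𝓝 0) := by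
  refine squeeze_zero' (g := fun n : ℕ => 1 / (n : ℝ)) ?_ ?_
    tendsto_one_div_atTop_nhds_zero_nat
  · exact Eventually.of_forall fun n => my_trigamma_nonneg (by positivity)
  · filter_upwards [eventually_gt_atTop 0] with n hn
    have hn' : (0 : ℝ) < n := Nat.cast_pos.2 hn
    have := my_trigamma_le (x := (n : ℝ) + 1) (by linarith)
    simpa using this

lemma my_trigamma_ge (n : ℕ) : 1 / ((n : ℝ) + 1) ≤ deriv digamma ((n : ℝ) + 1) := by
  let D : ℕ → ℝ := fun n => deriv digamma ((n : ℝ) + 1) - 1 / ((n : ℝ) + 1)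
  have hanti : Antitone D := by
    refine antitone_nat_of_succ_le fun n => ?_
    simp only [D]
    push_cast
    rw [my_deriv_digamma_add_one (by positivity)]
    generalize hy : (n : ℝ) + 1 = y
    have hy0 : 0 < y := by rw [← hy]; positivity
    have e : 1 / y ^ 2 + 1 / (y + 1) - 1 / y = 1 / (y ^ 2 * (y + 1)) := by
      field_simp
      ring
    have : 0 ≤ 1 / (y ^ 2 * (y + 1)) := by positivity
    linarith
  have hlim : Tendsto D atTop (𝓝 0) := by
    simpa [D] using my_trigamma_tendsto.sub tendsto_one_div_add_atTop_nhds_zero_nat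
  have := hanti.le_of_tendsto hlim n
  simp only [D] at this
  linarith

lemma my_digamma_nat (n : ℕ) :
    digamma ((n : ℝ) + 1) = -Real.eulerMascheroniConstant + (harmonic n : ℝ) := by
  unfold digamma
  rw [Real.deriv_Gamma_nat, Real.Gamma_nat_eq_factorial]
  have : (n.factorial : ℝ) ≠ 0 := by positivity
  field_simp

lemma my_digamma_log_tendsto :
    Tendsto (fun n : ℕ => digamma ((n : ℝ) + 1) - Real.log ((n : ℝ) + 1)) atTop (𝓝 0) := by
  have := Real.tendsto_harmonic_sub_log_add_one.sub_const Real.eulerMascheroniConstant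
  rw [sub_self] at this
  refine this.congr fun n => ?_
  rw [my_digamma_nat]
  ring

lemma my_log_succ {y : ℝ} (hy : 0 < y) : Real.log (y + 1) = Real.log y + Real.log (1 + 1 / y) := by
  rw [← Real.log_mul hy.ne' (by positivity)]
  congr 1
  field_simp

lemma my_u_nonneg (n : ℕ) : 0 ≤ digamma ((n : ℝ) + 1) - Real.log ((n : ℝ) + 1) +
          (1 / 2) * deriv digamma ((n : ℝ) + 1) := by
  let D : ℕ → ℝ := fun n => digamma ((n : ℝ) + 1) - Real.log ((n : ℝ) + 1) +
          (1 / 2) * deriv digamma ((n : ℝ) + 1)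
  have hanti : Antitone D := by
    refine antitone_nat_of_succ_le fun n => ?_
    simp only [D]
    push_cast
    have hp : (0 : ℝ) < (n : ℝ) + 1 := by positivity
    rw [my_deriv_digamma_add_one hp, my_digamma_add_one hp, my_log_succ hp]
    generalize (n : ℝ) + 1 = y at *
    have h1 := Real.le_log_one_add_of_nonneg (x := 1 / y) (by positivity)
    have e : 2 * (1 / y) / (1 / y + 2) - (1 / y - 1 / 2 * (1 / y ^ 2))
        = 1 / (2 * y ^ 2 * (1 + 2 * y)) := by
      field_simp
      ring
    have : 0 ≤ 1 / (2 * y ^ 2 * (1 + 2 * y)) := by positivity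
    linarith
  have hlim : Tendsto D atTop (𝓝 0) := by
    simpa using my_digamma_log_tendsto.add (my_trigamma_tendsto.const_mul (1 / 2))
  exact hanti.le_of_tendsto hlim n

lemma my_v_nonpos (n : ℕ) : digamma ((n : ℝ) + 1) - Real.log ((n : ℝ) + 1) +
          (1 / 2) * (1 / ((n : ℝ) + 1)) ≤ 0 := by
  let D : ℕ → ℝ := fun n => digamma ((n : ℝ) + 1) - Real.log ((n : ℝ) + 1) +
          (1 / 2) * (1 / ((n : ℝ) + 1))
  have hmono : Monotone D := by
    refine monotone_nat_of_le_succ fun n => ?_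
    simp only [D]
    push_cast
    have hp : (0 : ℝ) < (n : ℝ) + 1 := by positivity
    rw [my_digamma_add_one hp, my_log_succ hp]
    generalize (n : ℝ) + 1 = y at *
    have h0 : (0 : ℝ) < 1 + 1 / y := by positivity
    have h1 : Real.log (1 + 1 / y) ≤ Real.sinh (Real.log (1 + 1 / y)) :=
      Real.self_le_sinh_iff.2 (Real.log_nonneg (by
        have : 0 < 1 / y := by positivity
        linarith))
    rw [Real.sinh_log h0] at h1
    have e : (1 + 1 / y - (1 + 1 / y)⁻¹) / 2 = 1 / 2 * (1 / y) + 1 / 2 * (1 / (y + 1)) := by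
      field_simp
      ring
    have : 1 / y = 1 / 2 * (1 / y) + 1 / 2 * (1 / y) := by ring
    linarith
  have hlim : Tendsto D atTop (𝓝 0) := by
    have h := my_digamma_log_tendsto.add
      ((tendsto_one_div_add_atTop_nhds_zero_nat (𝕜 := ℝ)).const_mul (1 / 2))
    rwa [mul_zero, add_zero] at h
  exact hmono.ge_of_tendsto hlim n

lemma my_partial_sum (N : ℕ) : ∑ n ∈ Finset.range N,
    (digamma ((n : ℝ) + 1) - Real.log ((n : ℝ) + 1) + (1 / 2) * deriv digamma ((n : ℝ) + 1))
    = N * digamma ((N : ℝ) + 1) - N - Real.log (N.factorial : ℝ)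
      + (1 / 2) * (N * deriv digamma ((N : ℝ) + 1) + digamma ((N : ℝ) + 1)
        + Real.eulerMascheroniConstant) := by
  induction N with
  | zero =>
    have := my_digamma_nat 0
    simp at this
    simp [this]
  | succ N ih =>
    rw [Finset.sum_range_succ, ih, Nat.factorial_succ]
    have hp : (0 : ℝ) < (N : ℝ) + 1 := by positivity
    push_cast
    rw [Real.log_mul hp.ne' (by positivity), my_deriv_digamma_add_one hp, my_digamma_add_one hp]
    field_simp
    ring

lemma my_ratio_tendsto : Tendsto (fun n : ℕ => (n : ℝ) * (1 / ((n : ℝ) + 1))) atTop (𝓝 1) := by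
  refine (tendsto_natCast_div_add_atTop (𝕜 := ℝ) 1).congr fun n => ?_
  ring

lemma my_nT : Tendsto (fun n : ℕ => (n : ℝ) * deriv digamma ((n : ℝ) + 1)) atTop (𝓝 1) := by
  refine tendsto_of_tendsto_of_tendsto_of_le_of_le my_ratio_tendsto tendsto_const_nhds ?_ ?_
  · intro n
    exact mul_le_mul_of_nonneg_left (my_trigamma_ge n) (Nat.cast_nonneg n)
  · intro n
    rcases Nat.eq_zero_or_pos n with rfl | hn
    · simp
    · have hn' : (0 : ℝ) < n := Nat.cast_pos.2 hn
      have := my_trigamma_le (x := (n : ℝ) + 1) (by linarith)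
      rw [add_sub_cancel_right, le_div_iff₀ hn'] at this
      simp only
      linarith

lemma my_nP : Tendsto (fun n : ℕ => (n : ℝ) * (digamma ((n : ℝ) + 1) - Real.log ((n : ℝ) + 1)))
    atTop (𝓝 (-(1 / 2))) := by
  have a1 : Tendsto (fun n : ℕ => -(1 / 2) * ((n : ℝ) * deriv digamma ((n : ℝ) + 1))) atTop
      (𝓝 (-(1 / 2))) := by
    have h := my_nT.const_mul (-(1 / 2) : ℝ)
    rwa [mul_one] at h
  have a2 : Tendsto (fun n : ℕ => -(1 / 2) * ((n : ℝ) * (1 / ((n : ℝ) + 1)))) atTop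
      (𝓝 (-(1 / 2))) := by
    have h := my_ratio_tendsto.const_mul (-(1 / 2) : ℝ)
    rwa [mul_one] at h
  refine tendsto_of_tendsto_of_tendsto_of_le_of_le a1 a2 ?_ ?_
  · intro n
    have := mul_nonneg (Nat.cast_nonneg (α := ℝ) n) (my_u_nonneg n)
    simp only
    linarith
  · intro n
    have := mul_nonneg (Nat.cast_nonneg (α := ℝ) n) (neg_nonneg.2 (my_v_nonpos n))
    simp only
    linarith

/-- `∑_{n=1}^∞ [ψ(n) − log n + (1/2)ψ'(n)] = 1 + γ/2 − (1/2) log(2π)`,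
the series converging. -/
theorem tsum_digamma_sub_log_add_trigamma :
    HasSum (fun n : ℕ =>
        digamma ((n : ℝ) + 1) - Real.log ((n : ℝ) + 1) +
          (1 / 2) * deriv digamma ((n : ℝ) + 1))
      (1 + Real.eulerMascheroniConstant / 2 - (1 / 2) * Real.log (2 * π)) := by
  rw [hasSum_iff_tendsto_nat_of_nonneg my_u_nonneg]
  have hL : Tendsto (fun n : ℕ => (n : ℝ) * Real.log (1 + 1 / (n : ℝ))) atTop (𝓝 1) :=
    (Real.tendsto_mul_log_one_add_div_atTop 1).comp tendsto_natCast_atTop_atTop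
  have hL0 : Tendsto (fun n : ℕ => Real.log (1 + 1 / (n : ℝ))) atTop (𝓝 0) := by
    have := (hL.mul (tendsto_one_div_atTop_nhds_zero_nat (𝕜 := ℝ)))
    rw [mul_zero] at this
    refine this.congr' ?_
    filter_upwards [eventually_gt_atTop 0] with n hn
    have hn' : (n : ℝ) ≠ 0 := by positivity
    field_simp
  have hS : Tendsto (fun n : ℕ => Real.log (Stirling.stirlingSeq n)) atTop
      (𝓝 (Real.log (√π))) :=
    Stirling.tendsto_stirlingSeq_sqrt_pi.log (by positivity)
  have H := ((((my_nP.add hL).add ((my_digamma_log_tendsto.add hL0).const_mul (1 / 2))).add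
    (my_nT.const_mul (1 / 2))).add_const (Real.eulerMascheroniConstant / 2)).sub
      (hS.add_const (1 / 2 * Real.log 2))
  have hval : -(1 / 2) + 1 + 1 / 2 * (0 + 0) + 1 / 2 * 1 + Real.eulerMascheroniConstant / 2 -
      (Real.log (√π) + 1 / 2 * Real.log 2)
      = 1 + Real.eulerMascheroniConstant / 2 - (1 / 2) * Real.log (2 * π) := by
    rw [Real.log_sqrt Real.pi_nonneg, Real.log_mul two_ne_zero Real.pi_ne_zero]
    ring
  rw [hval] at H
  refine H.congr' ?_
  filter_upwards [eventually_gt_atTop 0] with n hn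
  have hn' : (0 : ℝ) < n := Nat.cast_pos.2 hn
  rw [my_partial_sum, Stirling.log_stirlingSeq_formula, my_log_succ hn',
    Real.log_mul two_ne_zero hn'.ne', Real.log_div hn'.ne' (Real.exp_ne_zero 1), Real.log_exp]
  ring
end
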